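/- arXiv:2409.09810 — 3 statements merged into one kernel-verified Lean document; each statement's English description precedes it below -/
import Mathlib

section
/- Let A be the convolution matrix of a discrete point spread function of radius r, so that A_{βγ} = 0 unless pixel γ lies within the (2r+1)×(2r+1) window centered at pixel β. Let Θ_α ⊆ [d] be the set containing α and all pixel indices within a frame of radius r around pixel α, and let Φ_α ⊆ [d] be the set containing α and all pixel indices within a frame of radius 2r around pixel α. Then the full conditional density of pixel x_α under the smoothed posterior π_ε satisfies π_ε(x_α | x_{∖α}) = π_ε(x_α | x_{Φ_α∖α}) ∝ exp(−Σ_{β∈Θ_α} V_β(x_{Φ_α})), where V_β(x) = (λ/2)(y_β − A_β x)² + δ√((D_β^(v) x)² + (D_β^(h) x)² + ε). In particular, the full conditional of x_α depends only on the pixels with indices in Φ_α. -/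
open MeasureTheory Matrix
open scoped Kronecker ENNReal

noncomputable section

abbrev Pix (n : ℕ) := Fin n × Fin n
abbrev Img (n : ℕ) := Pix n → ℝ

/-- The one-dimensional finite difference matrix `D_n` (zero boundary conditions). -/
def Dmat (n : ℕ) : Matrix (Fin n) (Fin n) ℝ :=
  Matrix.of fun i j => if j = i then (-1 : ℝ) else if (j : ℕ) = (i : ℕ) + 1 then 1 else 0

/-- Vertical finite differences `D^(v) = I_n ⊗ D_n`. -/
def Dv (n : ℕ) : Matrix (Pix n) (Pix n) ℝ := (1 : Matrix (Fin n) (Fin n) ℝ) ⊗ₖ Dmat n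

/-- Horizontal finite differences `D^(h) = D_n ⊗ I_n`. -/
def Dh (n : ℕ) : Matrix (Pix n) (Pix n) ℝ := Dmat n ⊗ₖ (1 : Matrix (Fin n) (Fin n) ℝ)

/-- Smoothed total variation; `ε = 0` recovers the exact TV. -/
def tv (n : ℕ) (ε : ℝ) (x : Img n) : ℝ :=
  ∑ α : Pix n, Real.sqrt (((Dv n).mulVec x α) ^ 2 + ((Dh n).mulVec x α) ^ 2 + ε)

/-- Unnormalized posterior density. -/
def dens (n : ℕ) (A : Matrix (Pix n) (Pix n) ℝ) (y : Img n) (lam del ε : ℝ) (x : Img n) : ℝ :=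
  Real.exp (-(lam / 2) * ∑ β : Pix n, (y β - A.mulVec x β) ^ 2 - del * tv n ε x)

/-- Normalized posterior probability measure. -/
def post (n : ℕ) (A : Matrix (Pix n) (Pix n) ℝ) (y : Img n) (lam del ε : ℝ) : Measure (Img n) :=
  (volume.withDensity (fun x => ENNReal.ofReal (dens n A y lam del ε x)) Set.univ)⁻¹ •
    volume.withDensity (fun x => ENNReal.ofReal (dens n A y lam del ε x))

/-- Euclidean (ℓ²) norm of a finitely indexed family. -/
def l2 {ι : Type*} [Fintype ι] (v : ι → ℝ) : ℝ := Real.sqrt (∑ i, v i ^ 2)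

abbrev Blk (n m : ℕ) := Fin (n / m) × Fin (n / m)

/-- The block containing a pixel. -/
def blkOf {n : ℕ} (m : ℕ) (hm : m ∣ n) (p : Pix n) : Blk n m :=
  (⟨(p.1 : ℕ) / m, Nat.div_lt_div_of_lt_of_dvd hm p.1.isLt⟩,
   ⟨(p.2 : ℕ) / m, Nat.div_lt_div_of_lt_of_dvd hm p.2.isLt⟩)

abbrev BlkPix {n : ℕ} (m : ℕ) (hm : m ∣ n) (i : Blk n m) := {p : Pix n // blkOf m hm p = i}

/-- Restriction of an image to the pixels of block `i`. -/
def blkRestrict {n : ℕ} (m : ℕ) (hm : m ∣ n) (i : Blk n m) (x : Img n) :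
    BlkPix m hm i → ℝ := fun p => x p.val

/-- Partial derivative of `f` at `x` in the direction of pixel `p`. -/
def pgrad {n : ℕ} (f : Img n → ℝ) (x : Img n) (p : Pix n) : ℝ :=
  fderiv ℝ f x (Pi.single p 1)

/-- Gradient of `f` with respect to the pixels of block `i`. -/
def blkGrad {n : ℕ} (m : ℕ) (hm : m ∣ n) (i : Blk n m) (f : Img n → ℝ) (x : Img n) :
    BlkPix m hm i → ℝ := fun p => pgrad f x p.val

/-- ℓ² operator norm of a real matrix. -/
def opNorm {ι κ : Type*} [Fintype ι] [Fintype κ] [DecidableEq ι] [DecidableEq κ]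
    (A : Matrix ι κ ℝ) : ℝ :=
  ‖LinearMap.toContinuousLinearMap (Matrix.toEuclideanLin A)‖

/-- The `(i,j)` sub-block of a pixel-indexed matrix. -/
def subBlk {n : ℕ} (m : ℕ) (hm : m ∣ n) (C : Matrix (Pix n) (Pix n) ℝ) (i j : Blk n m) :
    Matrix (BlkPix m hm i) (BlkPix m hm j) ℝ :=
  Matrix.of fun p q => C p.val q.val

/-- `c`-diagonal block dominance. -/
def DiagBlockDom {n : ℕ} (m : ℕ) (hm : m ∣ n) (C : Matrix (Pix n) (Pix n) ℝ) (c : ℝ) : Prop :=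
  C.PosDef ∧ ∃ M : Matrix (Blk n m) (Blk n m) ℝ, M.IsSymm ∧
    (∀ i, (subBlk m hm C i i - M i i • (1 : Matrix (BlkPix m hm i) (BlkPix m hm i) ℝ)).PosSemidef) ∧
    (∀ i j, i ≠ j → opNorm (subBlk m hm C i j) ≤ M i j) ∧
    (∀ i, (∑ j ∈ Finset.univ.erase i, M i j) + c ≤ M i i)

/-- Wasserstein-1 distance (w.r.t. the Euclidean norm) between measures on `ι → ℝ`. -/
def W1 {ι : Type*} [Fintype ι] (μ ν : Measure (ι → ℝ)) : ℝ :=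
  sInf {r | ∃ γ : Measure ((ι → ℝ) × (ι → ℝ)),
    γ.map Prod.fst = μ ∧ γ.map Prod.snd = ν ∧ r = ∫ p, l2 (p.1 - p.2) ∂γ}


/-- Maximal clique potential `V_β`. -/
def Vpot (n : ℕ) (A : Matrix (Pix n) (Pix n) ℝ) (y : Img n) (lam del ε : ℝ)
    (β : Pix n) (x : Img n) : ℝ :=
  lam / 2 * (y β - A.mulVec x β) ^ 2 +
    del * Real.sqrt (((Dv n).mulVec x β) ^ 2 + ((Dh n).mulVec x β) ^ 2 + ε)

/-- The square window of radius `ρ` around pixel `α` (a "frame of radius ρ", including `α`). -/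
def window (n : ℕ) (ρ : ℕ) (α : Pix n) : Finset (Pix n) :=
  Finset.univ.filter fun β => Nat.dist (β.1 : ℕ) (α.1 : ℕ) ≤ ρ ∧ Nat.dist (β.2 : ℕ) (α.2 : ℕ) ≤ ρ

/-- The full conditional density of pixel `α` given all other pixels, as a function of the
value `t` of pixel `α`. -/
def condDens (n : ℕ) (A : Matrix (Pix n) (Pix n) ℝ) (y : Img n) (lam del ε : ℝ)
    (α : Pix n) (x : Img n) (t : ℝ) : ℝ :=
  dens n A y lam del ε (Function.update x α t) /
    ∫ s : ℝ, dens n A y lam del ε (Function.update x α s)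

theorem mem_window {n ρ : ℕ} {α β : Pix n} :
    β ∈ window n ρ α ↔ Nat.dist (β.1 : ℕ) (α.1 : ℕ) ≤ ρ ∧ Nat.dist (β.2 : ℕ) (α.2 : ℕ) ≤ ρ := by
  simp [window]

theorem mem_window_comm {n ρ : ℕ} {α β : Pix n} : β ∈ window n ρ α ↔ α ∈ window n ρ β := by
  simp only [mem_window, Nat.dist_comm]

theorem mem_window_add {n ρ σ : ℕ} {α β γ : Pix n} (hβ : β ∈ window n ρ α)
    (hγ : γ ∈ window n σ β) : γ ∈ window n (ρ + σ) α := by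
  simp only [mem_window, Nat.dist] at *
  omega

theorem Dmat_eq_zero {n : ℕ} {i j : Fin n} (h : 1 < Nat.dist (i : ℕ) (j : ℕ)) :
    Dmat n i j = 0 := by
  have h₁ : j ≠ i := by
    rintro rfl
    simp at h
  have h₂ : (j : ℕ) ≠ i + 1 := by
    simp only [Nat.dist] at h
    omega
  simp [Dmat, h₁, h₂]

theorem Dv_eq_zero {n r : ℕ} (hr : 1 ≤ r) {β γ : Pix n} (h : γ ∉ window n r β) :
    Dv n β γ = 0 := by
  rw [Dv, kroneckerMap_apply, Matrix.one_apply]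
  split_ifs with h₁
  · rw [Dmat_eq_zero, mul_zero]
    simp only [mem_window, h₁, Nat.dist] at h ⊢
    omega
  · exact zero_mul _

theorem Dh_eq_zero {n r : ℕ} (hr : 1 ≤ r) {β γ : Pix n} (h : γ ∉ window n r β) :
    Dh n β γ = 0 := by
  rw [Dh, kroneckerMap_apply, Matrix.one_apply]
  split_ifs with h₁
  · rw [Dmat_eq_zero, zero_mul]
    simp only [mem_window, h₁, Nat.dist] at h ⊢
    omega
  · exact mul_zero _

theorem mulVec_congr_of_support {ι κ : Type*} [Fintype κ] {M : Matrix ι κ ℝ} {i : ι}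
    {s : Finset κ} (hM : ∀ k, k ∉ s → M i k = 0) {x x' : κ → ℝ} (h : ∀ k ∈ s, x k = x' k) :
    M.mulVec x i = M.mulVec x' i := by
  simp only [mulVec, dotProduct]
  refine Finset.sum_congr rfl fun k _ => ?_
  by_cases hk : k ∈ s
  · rw [h k hk]
  · rw [hM k hk, zero_mul, zero_mul]

theorem Vpot_congr {n r : ℕ} (hr : 1 ≤ r) {A : Matrix (Pix n) (Pix n) ℝ} {β : Pix n}
    (hA : ∀ γ, γ ∉ window n r β → A β γ = 0) (y : Img n) (lam del ε : ℝ) {x x' : Img n}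
    (h : ∀ p ∈ window n r β, x p = x' p) :
    Vpot n A y lam del ε β x = Vpot n A y lam del ε β x' := by
  simp only [Vpot, mulVec_congr_of_support hA h,
    mulVec_congr_of_support (fun _ => Dv_eq_zero hr) h,
    mulVec_congr_of_support (fun _ => Dh_eq_zero hr) h]

theorem dens_eq_exp_neg_sum_Vpot (n : ℕ) (A : Matrix (Pix n) (Pix n) ℝ) (y : Img n)
    (lam del ε : ℝ) (x : Img n) :
    dens n A y lam del ε x = Real.exp (-∑ β, Vpot n A y lam del ε β x) := by
  simp only [dens, Vpot, tv, Finset.sum_add_distrib, ← Finset.mul_sum]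
  congr 1
  ring

theorem dens_update {n r : ℕ} (hr : 1 ≤ r) {A : Matrix (Pix n) (Pix n) ℝ}
    (hA : ∀ β γ, γ ∉ window n r β → A β γ = 0) (y : Img n) (lam del ε : ℝ)
    (α : Pix n) (x : Img n) (t : ℝ) :
    dens n A y lam del ε (Function.update x α t) =
      Real.exp (-∑ β ∈ (window n r α)ᶜ, Vpot n A y lam del ε β x) *
        Real.exp (-∑ β ∈ window n r α, Vpot n A y lam del ε β (Function.update x α t)) := by
  rw [dens_eq_exp_neg_sum_Vpot, ← Real.exp_add,
    ← Finset.sum_compl_add_sum (window n r α), neg_add]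
  congr 3
  refine Finset.sum_congr rfl fun β hβ => Vpot_congr hr (hA β) y lam del ε fun p hp => ?_
  refine Function.update_of_ne ?_ _ _
  rintro rfl
  exact Finset.mem_compl.mp hβ (mem_window_comm.mp hp)

theorem Dv_mulVec_update (n : ℕ) (α : Pix n) (x : Img n) (t : ℝ) :
    (Dv n).mulVec (Function.update x α t) α =
      (Dv n).mulVec (Function.update x α 0) α - t := by
  have h : Function.update x α t = Function.update x α 0 + Pi.single α t := by
    ext p
    by_cases hp : p = α
    · subst hp; simp
    · simp [hp]
  rw [h, mulVec_add, Pi.add_apply, mulVec_single]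
  simp [Dv, Dmat, sub_eq_add_neg]

theorem integrable_exp_neg_mul_abs {b : ℝ} (hb : 0 < b) :
    Integrable fun t : ℝ => Real.exp (-b * |t|) := by
  rw [← integrableOn_univ, ← Set.Iic_union_Ioi (a := (0 : ℝ))]
  refine IntegrableOn.union ?_ ?_
  · refine (integrableOn_exp_mul_Iic hb 0).congr_fun (fun t ht => ?_) measurableSet_Iic
    simp only [abs_of_nonpos (Set.mem_Iic.mp ht), neg_mul_neg]
  · refine (integrableOn_exp_mul_Ioi (neg_neg_of_pos hb) 0).congr_fun (fun t ht => ?_)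
      measurableSet_Ioi
    simp only [abs_of_pos (Set.mem_Ioi.mp ht)]

theorem integrable_dens_update (n : ℕ) (A : Matrix (Pix n) (Pix n) ℝ) (y : Img n)
    {lam del ε : ℝ} (hlam : 0 ≤ lam) (hdel : 0 < del) (hε : 0 ≤ ε) (α : Pix n) (x : Img n) :
    Integrable fun t : ℝ => dens n A y lam del ε (Function.update x α t) := by
  set c := (Dv n).mulVec (Function.update x α 0) α with hc
  have hbound : Integrable fun t : ℝ => Real.exp (-del * |t - c|) :=
    (integrable_exp_neg_mul_abs hdel).comp_sub_right c
  refine hbound.mono' ?_ (Filter.Eventually.of_forall fun t => ?_)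
  · refine Continuous.aestronglyMeasurable ?_
    have hM (M : Matrix (Pix n) (Pix n) ℝ) (β : Pix n) :
        Continuous fun t : ℝ => M.mulVec (Function.update x α t) β :=
      (continuous_apply β).comp
        (continuous_const.matrix_mulVec (continuous_const.update α continuous_id))
    have hMA := hM A
    have hMv := hM (Dv n)
    have hMh := hM (Dh n)
    unfold dens tv
    fun_prop
  · rw [dens_eq_exp_neg_sum_Vpot, Real.norm_eq_abs, Real.abs_exp, Real.exp_le_exp, neg_mul,
      neg_le_neg_iff]
    have hV (β : Pix n) : 0 ≤ Vpot n A y lam del ε β (Function.update x α t) := by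
      unfold Vpot
      positivity
    refine le_trans ?_ (Finset.single_le_sum (fun β _ => hV β) (Finset.mem_univ α))
    have hsqrt : |t - c| ≤ Real.sqrt (((Dv n).mulVec (Function.update x α t) α) ^ 2 +
        ((Dh n).mulVec (Function.update x α t) α) ^ 2 + ε) := by
      refine Real.abs_le_sqrt ?_
      rw [Dv_mulVec_update, ← hc]
      nlinarith [sq_nonneg ((Dh n).mulVec (Function.update x α t) α)]
    refine (mul_le_mul_of_nonneg_left hsqrt hdel.le).trans ?_
    unfold Vpot
    exact le_add_of_nonneg_left (by positivity)

theorem integral_dens_update_pos (n : ℕ) (A : Matrix (Pix n) (Pix n) ℝ) (y : Img n)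
    {lam del ε : ℝ} (hlam : 0 ≤ lam) (hdel : 0 < del) (hε : 0 ≤ ε) (α : Pix n) (x : Img n) :
    0 < ∫ s : ℝ, dens n A y lam del ε (Function.update x α s) :=
  integral_exp_pos (integrable_dens_update n A y hlam hdel hε α x)

/-- Lemma 5.1, single-pixel version: for a convolution matrix `A` with PSF
radius `r`, with `Θ_α` the radius-`r` window and `Φ_α` the radius-`2r` window around `α`:
each clique potential `V_β`, `β ∈ Θ_α`, depends only on the pixels in `Φ_α`; the full
conditional of `x_α` is proportional to `exp(−Σ_{β∈Θ_α} V_β)`; and the full conditional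
depends only on the pixels in `Φ_α ∖ {α}`. -/
theorem stmt3 (n r : ℕ) (hr : 1 ≤ r) (A : Matrix (Pix n) (Pix n) ℝ) (y : Img n)
    (lam del ε : ℝ) (hlam : 0 < lam) (hdel : 0 < del) (hε : 0 < ε)
    (hA : ∀ β γ : Pix n, (r < Nat.dist (β.1 : ℕ) (γ.1 : ℕ) ∨ r < Nat.dist (β.2 : ℕ) (γ.2 : ℕ)) →
      A β γ = 0)
    (α : Pix n) :
    (∀ β ∈ window n r α, ∀ x x' : Img n, (∀ p ∈ window n (2 * r) α, x p = x' p) →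
        Vpot n A y lam del ε β x = Vpot n A y lam del ε β x') ∧
    (∀ x : Img n, ∃ C : ℝ, 0 < C ∧ ∀ t : ℝ,
        condDens n A y lam del ε α x t =
          C * Real.exp (-∑ β ∈ window n r α, Vpot n A y lam del ε β (Function.update x α t))) ∧
    (∀ x x' : Img n, (∀ p ∈ (window n (2 * r) α).erase α, x p = x' p) →
        condDens n A y lam del ε α x = condDens n A y lam del ε α x') := by
  have hA' : ∀ β γ, γ ∉ window n r β → A β γ = 0 := fun β γ h => hA β γ <| by
    simp only [mem_window, Nat.dist] at h ⊢
    omega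
  have hV : ∀ β ∈ window n r α, ∀ x x' : Img n, (∀ p ∈ window n (2 * r) α, x p = x' p) →
      Vpot n A y lam del ε β x = Vpot n A y lam del ε β x' := fun β hβ x x' h =>
    Vpot_congr hr (hA' β) y lam del ε fun p hp => h p (two_mul r ▸ mem_window_add hβ hp)
  refine ⟨hV, fun x => ?_, fun x x' h => funext fun t => ?_⟩
  · refine ⟨Real.exp (-∑ β ∈ (window n r α)ᶜ, Vpot n A y lam del ε β x) /
      ∫ s : ℝ, dens n A y lam del ε (Function.update x α s), ?_, fun t => ?_⟩
    · exact div_pos (Real.exp_pos _)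
        (integral_dens_update_pos n A y hlam.le hdel hε.le α x)
    · rw [condDens, dens_update hr hA', div_mul_eq_mul_div]
  · have hlocal (s : ℝ) :
        ∑ β ∈ window n r α, Vpot n A y lam del ε β (Function.update x α s) =
          ∑ β ∈ window n r α, Vpot n A y lam del ε β (Function.update x' α s) := by
      refine Finset.sum_congr rfl fun β hβ => hV β hβ _ _ fun p hp => ?_
      by_cases hpα : p = α
      · subst hpα
        simp
      · simp [hpα, h p (Finset.mem_erase.mpr ⟨hpα, hp⟩)]
    simp only [condDens, dens_update hr hA', integral_const_mul, hlocal]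
    rw [mul_div_mul_left _ _ (Real.exp_ne_zero _), mul_div_mul_left _ _ (Real.exp_ne_zero _)]

end
end

section
/- Assume AᵀA is c-diagonal block dominant and λ/δ ≥ 64m/(c√ε). Then for every block i, the Wasserstein-1 distance between the marginals of π and π_ε on block x_i satisfies the Stein's-method bound max_i W₁(π_i, π_{ε,i}) ≤ (2/(λc)) · max_j ‖∇_j log π_ε − ∇_j log π‖_{L¹(π)}, where ∇_j log π is the (almost-everywhere defined) block gradient of the log posterior and ‖·‖_{L¹(π)} denotes ∫ ‖·‖₂ dπ. -/
open MeasureTheory Matrix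
open scoped Kronecker ENNReal

noncomputable section

section Coupling

variable {X : Type*} [MeasurableSpace X]

/-- The image under `T` of the measure with density `w` with respect to `γ`. -/
def moved (γ : Measure X) (w : X → ℝ) (T : X → X) : Measure X :=
  (γ.withDensity fun z => ENNReal.ofReal (w z)).map T

lemma lintegral_moved (γ : Measure X) {w : X → ℝ} {T : X → X} (hw : Measurable w)
    (hT : Measurable T) {F : X → ℝ≥0∞} (hF : Measurable F) :
    ∫⁻ z, F z ∂moved γ w T = ∫⁻ z, ENNReal.ofReal (w z) * F (T z) ∂γ := by
  rw [moved, lintegral_map hF hT,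
    lintegral_withDensity_eq_lintegral_mul _ hw.ennreal_ofReal
      (g := fun z => F (T z)) (hF.comp hT)]
  rfl

lemma integral_moved (γ : Measure X) {w : X → ℝ} {T : X → X} (hw : Measurable w)
    (hw0 : ∀ z, 0 ≤ w z) (hT : Measurable T) {F : X → ℝ} (hF : Measurable F) :
    ∫ z, F z ∂moved γ w T = ∫ z, w z * F (T z) ∂γ := by
  rw [moved, integral_map hT.aemeasurable hF.aestronglyMeasurable,
    integral_withDensity_eq_integral_toReal_smul hw.ennreal_ofReal (by simp)]
  simp [ENNReal.toReal_ofReal (hw0 _)]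

lemma integrable_moved {γ : Measure X} {w : X → ℝ} {T : X → X} (hw : Measurable w)
    (hw0 : ∀ z, 0 ≤ w z) (hT : Measurable T) {F : X → ℝ} (hF : Measurable F)
    (h : Integrable (fun z => w z * F (T z)) γ) : Integrable F (moved γ w T) := by
  rw [moved, integrable_map_measure hF.aestronglyMeasurable hT.aemeasurable,
    integrable_withDensity_iff_integrable_smul' hw.ennreal_ofReal (by simp)]
  simpa [ENNReal.toReal_ofReal (hw0 _)] using h

end Coupling

section Step

variable {X : Type*} [MeasurableSpace X] [Add X] [MeasurableAdd₂ X]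
  {ι : Type*} [Fintype ι]

/-- One step of two chains, coupled so that they accept the same proposal as often as possible:
a proposal `v i` is drawn uniformly, and accepted with probability `a₀ i` by the first chain and
`a₁ i` by the second one. -/
def coupledStep (γ : Measure (X × X)) (a₀ a₁ : ι → X → ℝ) (v : ι → X) : Measure (X × X) :=
  (Fintype.card ι : ℝ≥0∞)⁻¹ • ∑ i,
    (moved γ (fun z => min (a₀ i z.1) (a₁ i z.2)) (fun z => (z.1 + v i, z.2 + v i)) +
     moved γ (fun z => a₀ i z.1 - min (a₀ i z.1) (a₁ i z.2)) (fun z => (z.1 + v i, z.2)) +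
     moved γ (fun z => a₁ i z.2 - min (a₀ i z.1) (a₁ i z.2)) (fun z => (z.1, z.2 + v i)) +
     moved γ (fun z => 1 - max (a₀ i z.1) (a₁ i z.2)) id)

/-- Invariance of `μ` under the chain with proposals `v` and acceptance probabilities `a`. -/
def InvariantUnder (μ : Measure X) (a : ι → X → ℝ) (v : ι → X) : Prop :=
  ∀ f : X → ℝ≥0∞, Measurable f →
    ∑ i, ∫⁻ x, (ENNReal.ofReal (a i x) * f (x + v i) + ENNReal.ofReal (1 - a i x) * f x) ∂μ =
      Fintype.card ι * ∫⁻ x, f x ∂μ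

variable {γ : Measure (X × X)} {a₀ a₁ : ι → X → ℝ} {v : ι → X}

lemma lintegral_coupledStep (hm₀ : ∀ i, Measurable (a₀ i)) (hm₁ : ∀ i, Measurable (a₁ i))
    {F : X × X → ℝ≥0∞} (hF : Measurable F) :
    ∫⁻ z, F z ∂coupledStep γ a₀ a₁ v = (Fintype.card ι : ℝ≥0∞)⁻¹ * ∑ i, ∫⁻ z,
      (ENNReal.ofReal (min (a₀ i z.1) (a₁ i z.2)) * F (z.1 + v i, z.2 + v i) +
       ENNReal.ofReal (a₀ i z.1 - min (a₀ i z.1) (a₁ i z.2)) * F (z.1 + v i, z.2) +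
       ENNReal.ofReal (a₁ i z.2 - min (a₀ i z.1) (a₁ i z.2)) * F (z.1, z.2 + v i) +
       ENNReal.ofReal (1 - max (a₀ i z.1) (a₁ i z.2)) * F z) ∂γ := by
  have h0 : ∀ i, Measurable fun z : X × X => a₀ i z.1 := fun i => (hm₀ i).comp measurable_fst
  have h1 : ∀ i, Measurable fun z : X × X => a₁ i z.2 := fun i => (hm₁ i).comp measurable_snd
  rw [coupledStep, lintegral_smul_measure, lintegral_finsetSum_measure, smul_eq_mul]
  congr 1
  refine Finset.sum_congr rfl fun i _ => ?_
  have m1 := (h0 i).min (h1 i)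
  have m2 : Measurable fun z : X × X => a₀ i z.1 - min (a₀ i z.1) (a₁ i z.2) := (h0 i).sub m1
  have m3 : Measurable fun z : X × X => a₁ i z.2 - min (a₀ i z.1) (a₁ i z.2) := (h1 i).sub m1
  have m4 : Measurable fun z : X × X => 1 - max (a₀ i z.1) (a₁ i z.2) :=
    measurable_const.sub ((h0 i).max (h1 i))
  have t1 : Measurable fun z : X × X => (z.1 + v i, z.2 + v i) := by fun_prop
  have t2 : Measurable fun z : X × X => (z.1 + v i, z.2) := by fun_prop
  have t3 : Measurable fun z : X × X => (z.1, z.2 + v i) := by fun_prop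
  rw [lintegral_add_measure, lintegral_add_measure, lintegral_add_measure,
    lintegral_moved γ m1 t1 hF, lintegral_moved γ m2 t2 hF,
    lintegral_moved γ m3 t3 hF,
    lintegral_moved γ m4 measurable_id hF]
  have p2 : Measurable fun z : X × X =>
      ENNReal.ofReal (a₀ i z.1 - min (a₀ i z.1) (a₁ i z.2)) * F (z.1 + v i, z.2) :=
    m2.ennreal_ofReal.mul (hF.comp t2)
  have p3 : Measurable fun z : X × X =>
      ENNReal.ofReal (a₁ i z.2 - min (a₀ i z.1) (a₁ i z.2)) * F (z.1, z.2 + v i) :=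
    m3.ennreal_ofReal.mul (hF.comp t3)
  have p4 : Measurable fun z : X × X => ENNReal.ofReal (1 - max (a₀ i z.1) (a₁ i z.2)) * F z :=
    m4.ennreal_ofReal.mul hF
  rw [lintegral_add_right _ p4, lintegral_add_right _ p3, lintegral_add_right _ p2]
  rfl

lemma map_fst_coupledStep [Nonempty ι] (hm₀ : ∀ i, Measurable (a₀ i)) (hm₁ : ∀ i, Measurable (a₁ i))
    (h₀ : ∀ i x, a₀ i x ∈ Set.Icc (0 : ℝ) 1) (h₁ : ∀ i x, a₁ i x ∈ Set.Icc (0 : ℝ) 1)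
    (hb : InvariantUnder (γ.map Prod.fst) a₀ v) :
    (coupledStep γ a₀ a₁ v).map Prod.fst = γ.map Prod.fst := by
  refine Measure.ext_of_lintegral _ fun f hf => ?_
  rw [lintegral_map hf measurable_fst,
    lintegral_coupledStep (F := fun z => f z.1) hm₀ hm₁ (hf.comp measurable_fst)]
  have hc : (Fintype.card ι : ℝ≥0∞) ≠ 0 := by simp
  suffices h : ∑ i, _ = Fintype.card ι * ∫⁻ x, f x ∂γ.map Prod.fst by
    rw [h, ← mul_assoc, ENNReal.inv_mul_cancel hc (by simp), one_mul]
  rw [← hb f hf]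
  refine Finset.sum_congr rfl fun i _ => ?_
  have hg : Measurable fun x =>
      ENNReal.ofReal (a₀ i x) * f (x + v i) + ENNReal.ofReal (1 - a₀ i x) * f x :=
    ((hm₀ i).ennreal_ofReal.mul (hf.comp (measurable_add_const _))).add
      ((measurable_const.sub (hm₀ i)).ennreal_ofReal.mul hf)
  rw [lintegral_map hg measurable_fst]
  refine lintegral_congr fun z => ?_
  have e1 : a₀ i z.1 = min (a₀ i z.1) (a₁ i z.2) + (a₀ i z.1 - min (a₀ i z.1) (a₁ i z.2)) := by
    ring
  have e2 : 1 - a₀ i z.1 = (a₁ i z.2 - min (a₀ i z.1) (a₁ i z.2)) +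
      (1 - max (a₀ i z.1) (a₁ i z.2)) := by
    linarith [min_add_max (a₀ i z.1) (a₁ i z.2)]
  conv_rhs => rw [e2]; enter [1]; rw [e1]
  rw [ENNReal.ofReal_add (le_min (h₀ i z.1).1 (h₁ i z.2).1) (sub_nonneg.2 (min_le_left _ _)),
    ENNReal.ofReal_add (sub_nonneg.2 (min_le_right _ _))
      (sub_nonneg.2 (max_le (h₀ i z.1).2 (h₁ i z.2).2))]
  ring

lemma map_snd_coupledStep [Nonempty ι] (hm₀ : ∀ i, Measurable (a₀ i)) (hm₁ : ∀ i, Measurable (a₁ i))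
    (h₀ : ∀ i x, a₀ i x ∈ Set.Icc (0 : ℝ) 1) (h₁ : ∀ i x, a₁ i x ∈ Set.Icc (0 : ℝ) 1)
    (hb : InvariantUnder (γ.map Prod.snd) a₁ v) :
    (coupledStep γ a₀ a₁ v).map Prod.snd = γ.map Prod.snd := by
  refine Measure.ext_of_lintegral _ fun f hf => ?_
  rw [lintegral_map hf measurable_snd,
    lintegral_coupledStep (F := fun z => f z.2) hm₀ hm₁ (hf.comp measurable_snd)]
  have hc : (Fintype.card ι : ℝ≥0∞) ≠ 0 := by simp
  suffices h : ∑ i, _ = Fintype.card ι * ∫⁻ x, f x ∂γ.map Prod.snd by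
    rw [h, ← mul_assoc, ENNReal.inv_mul_cancel hc (by simp), one_mul]
  rw [← hb f hf]
  refine Finset.sum_congr rfl fun i _ => ?_
  have hg : Measurable fun x =>
      ENNReal.ofReal (a₁ i x) * f (x + v i) + ENNReal.ofReal (1 - a₁ i x) * f x :=
    ((hm₁ i).ennreal_ofReal.mul (hf.comp (measurable_add_const _))).add
      ((measurable_const.sub (hm₁ i)).ennreal_ofReal.mul hf)
  rw [lintegral_map hg measurable_snd]
  refine lintegral_congr fun z => ?_
  have e1 : a₁ i z.2 = min (a₀ i z.1) (a₁ i z.2) + (a₁ i z.2 - min (a₀ i z.1) (a₁ i z.2)) := by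
    ring
  have e2 : 1 - a₁ i z.2 = (a₀ i z.1 - min (a₀ i z.1) (a₁ i z.2)) +
      (1 - max (a₀ i z.1) (a₁ i z.2)) := by
    linarith [min_add_max (a₀ i z.1) (a₁ i z.2)]
  conv_rhs => rw [e2]; enter [1]; rw [e1]
  rw [ENNReal.ofReal_add (le_min (h₀ i z.1).1 (h₁ i z.2).1) (sub_nonneg.2 (min_le_right _ _)),
    ENNReal.ofReal_add (sub_nonneg.2 (min_le_left _ _))
      (sub_nonneg.2 (max_le (h₀ i z.1).2 (h₁ i z.2).2))]
  ring

lemma integral_coupledStep [Nonempty ι] (hm₀ : ∀ i, Measurable (a₀ i))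
    (hm₁ : ∀ i, Measurable (a₁ i))
    (h₀ : ∀ i x, a₀ i x ∈ Set.Icc (0 : ℝ) 1) (h₁ : ∀ i x, a₁ i x ∈ Set.Icc (0 : ℝ) 1)
    {F : X × X → ℝ} (hF : Measurable F)
    (hi0 : Integrable F γ)
    (hi1 : ∀ i, Integrable (fun z => F (z.1 + v i, z.2)) γ)
    (hi2 : ∀ i, Integrable (fun z => F (z.1, z.2 + v i)) γ)
    (hinv : ∀ i x y, F (x + v i, y + v i) = F (x, y)) :
    ∫ z, F z ∂coupledStep γ a₀ a₁ v = ∫ z, F z ∂γ + (Fintype.card ι : ℝ)⁻¹ * ∑ i, ∫ z,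
      ((a₀ i z.1 - min (a₀ i z.1) (a₁ i z.2)) * (F (z.1 + v i, z.2) - F z) +
       (a₁ i z.2 - min (a₀ i z.1) (a₁ i z.2)) * (F (z.1, z.2 + v i) - F z)) ∂γ := by
  have h0 : ∀ i, Measurable fun z : X × X => a₀ i z.1 := fun i => (hm₀ i).comp measurable_fst
  have h1 : ∀ i, Measurable fun z : X × X => a₁ i z.2 := fun i => (hm₁ i).comp measurable_snd
  have hmin : ∀ i, Measurable fun z : X × X => min (a₀ i z.1) (a₁ i z.2) :=
    fun i => (h0 i).min (h1 i)
  have hmax : ∀ i, Measurable fun z : X × X => max (a₀ i z.1) (a₁ i z.2) :=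
    fun i => (h0 i).max (h1 i)
  have bdd : ∀ {w : X × X → ℝ} {G : X × X → ℝ}, Measurable w → (∀ z, 0 ≤ w z) →
      (∀ z, w z ≤ 1) → Integrable G γ → Integrable (fun z => w z * G z) γ :=
    fun hw hw0 hw1 hG => hG.bdd_mul (c := 1) hw.aestronglyMeasurable
      (Filter.Eventually.of_forall fun z => by
        rw [Real.norm_of_nonneg (hw0 z)]; exact hw1 z)
  have n1 : ∀ i (z : X × X), 0 ≤ min (a₀ i z.1) (a₁ i z.2) := fun i z =>
    le_min (h₀ i z.1).1 (h₁ i z.2).1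
  have n2 : ∀ i (z : X × X), 0 ≤ a₀ i z.1 - min (a₀ i z.1) (a₁ i z.2) := fun i z =>
    sub_nonneg.2 (min_le_left _ _)
  have n3 : ∀ i (z : X × X), 0 ≤ a₁ i z.2 - min (a₀ i z.1) (a₁ i z.2) := fun i z =>
    sub_nonneg.2 (min_le_right _ _)
  have n4 : ∀ i (z : X × X), 0 ≤ 1 - max (a₀ i z.1) (a₁ i z.2) := fun i z =>
    sub_nonneg.2 (max_le (h₀ i z.1).2 (h₁ i z.2).2)
  have u1 : ∀ i (z : X × X), min (a₀ i z.1) (a₁ i z.2) ≤ 1 := fun i z =>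
    (min_le_left _ _).trans (h₀ i z.1).2
  have u2 : ∀ i (z : X × X), a₀ i z.1 - min (a₀ i z.1) (a₁ i z.2) ≤ 1 := fun i z => by
    linarith [n1 i z, (h₀ i z.1).2]
  have u3 : ∀ i (z : X × X), a₁ i z.2 - min (a₀ i z.1) (a₁ i z.2) ≤ 1 := fun i z => by
    linarith [n1 i z, (h₁ i z.2).2]
  have u4 : ∀ i (z : X × X), 1 - max (a₀ i z.1) (a₁ i z.2) ≤ 1 := fun i z => by
    linarith [(h₀ i z.1).1.trans (le_max_left _ (a₁ i z.2))]
  have t1 : ∀ i, Measurable fun z : X × X => (z.1 + v i, z.2 + v i) := fun i => by fun_prop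
  have t2 : ∀ i, Measurable fun z : X × X => (z.1 + v i, z.2) := fun i => by fun_prop
  have t3 : ∀ i, Measurable fun z : X × X => (z.1, z.2 + v i) := fun i => by fun_prop
  have m2 : ∀ i, Measurable fun z : X × X => a₀ i z.1 - min (a₀ i z.1) (a₁ i z.2) :=
    fun i => (h0 i).sub (hmin i)
  have m3 : ∀ i, Measurable fun z : X × X => a₁ i z.2 - min (a₀ i z.1) (a₁ i z.2) :=
    fun i => (h1 i).sub (hmin i)
  have m4 : ∀ i, Measurable fun z : X × X => 1 - max (a₀ i z.1) (a₁ i z.2) :=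
    fun i => measurable_const.sub (hmax i)
  have w1 : ∀ i, Integrable
      (fun z : X × X => min (a₀ i z.1) (a₁ i z.2) * F (z.1 + v i, z.2 + v i)) γ :=
    fun i => bdd (hmin i) (n1 i) (u1 i) (by simpa only [hinv] using hi0)
  have w2 := fun i => bdd (m2 i) (n2 i) (u2 i) (hi1 i)
  have w3 := fun i => bdd (m3 i) (n3 i) (u3 i) (hi2 i)
  have w4 := fun i => bdd (m4 i) (n4 i) (u4 i) hi0
  have w12 : ∀ i, Integrable
      (fun z : X × X => min (a₀ i z.1) (a₁ i z.2) * F (z.1 + v i, z.2 + v i) +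
        (a₀ i z.1 - min (a₀ i z.1) (a₁ i z.2)) * F (z.1 + v i, z.2)) γ :=
    fun i => (w1 i).add (w2 i)
  have w123 : ∀ i, Integrable
      (fun z : X × X => min (a₀ i z.1) (a₁ i z.2) * F (z.1 + v i, z.2 + v i) +
        (a₀ i z.1 - min (a₀ i z.1) (a₁ i z.2)) * F (z.1 + v i, z.2) +
        (a₁ i z.2 - min (a₀ i z.1) (a₁ i z.2)) * F (z.1, z.2 + v i)) γ :=
    fun i => (w12 i).add (w3 i)
  have j1 := fun i => integrable_moved (hmin i) (n1 i) (t1 i) hF (w1 i)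
  have j2 := fun i => integrable_moved (m2 i) (n2 i) (t2 i) hF (w2 i)
  have j3 := fun i => integrable_moved (m3 i) (n3 i) (t3 i) hF (w3 i)
  have j4 := fun i => integrable_moved (T := id) (m4 i) (n4 i)
    measurable_id hF (w4 i)
  have key : ∀ i, ∫ z, F z ∂(moved γ (fun z => min (a₀ i z.1) (a₁ i z.2))
        (fun z => (z.1 + v i, z.2 + v i)) +
      moved γ (fun z => a₀ i z.1 - min (a₀ i z.1) (a₁ i z.2)) (fun z => (z.1 + v i, z.2)) +
      moved γ (fun z => a₁ i z.2 - min (a₀ i z.1) (a₁ i z.2)) (fun z => (z.1, z.2 + v i)) +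
      moved γ (fun z => 1 - max (a₀ i z.1) (a₁ i z.2)) id) =
      ∫ z, F z ∂γ + ∫ z,
      ((a₀ i z.1 - min (a₀ i z.1) (a₁ i z.2)) * (F (z.1 + v i, z.2) - F z) +
       (a₁ i z.2 - min (a₀ i z.1) (a₁ i z.2)) * (F (z.1, z.2 + v i) - F z)) ∂γ := by
    intro i
    rw [integral_add_measure (((j1 i).add_measure (j2 i)).add_measure (j3 i)) (j4 i),
      integral_add_measure ((j1 i).add_measure (j2 i)) (j3 i),
      integral_add_measure (j1 i) (j2 i),
      integral_moved γ (hmin i) (n1 i) (t1 i) hF,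
      integral_moved γ (m2 i) (n2 i) (t2 i) hF,
      integral_moved γ (m3 i) (n3 i) (t3 i) hF,
      integral_moved γ (m4 i) (n4 i) measurable_id hF]
    simp only [id_eq]
    rw [← integral_add (w1 i) (w2 i), ← integral_add (w12 i) (w3 i),
      ← integral_add (w123 i) (w4 i), ← integral_add hi0]
    · refine integral_congr_ae (Filter.Eventually.of_forall fun z => ?_)
      have := min_add_max (a₀ i z.1) (a₁ i z.2)
      have e : max (a₀ i z.1) (a₁ i z.2) = a₀ i z.1 + a₁ i z.2 - min (a₀ i z.1) (a₁ i z.2) := by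
        linarith
      simp only [hinv, e]
      ring
    · exact (bdd (m2 i) (n2 i) (u2 i) ((hi1 i).sub hi0)).add
        (bdd (m3 i) (n3 i) (u3 i) ((hi2 i).sub hi0))
  rw [coupledStep, integral_smul_measure, integral_finsetSum_measure
    (fun i _ => (((j1 i).add_measure (j2 i)).add_measure (j3 i)).add_measure (j4 i)),
    Finset.sum_congr rfl fun i _ => key i, Finset.sum_add_distrib]
  have hc : (Fintype.card ι : ℝ) ≠ 0 := by simp
  simp [mul_add, hc]

end Step

section Barker

variable {P : Type*}

/-- The proposal `± s` at one coordinate. -/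
def stepVec [DecidableEq P] (s : ℝ) (i : P × Bool) : P → ℝ := Pi.single i.1 (if i.2 then s else -s)

/-- The Barker acceptance probability of the move `v` for the log-density `L`. -/
def barker (L : (P → ℝ) → ℝ) (v x : P → ℝ) : ℝ := Real.sigmoid (L (x + v) - L x)

lemma barker_mem_Icc (L : (P → ℝ) → ℝ) (v x : P → ℝ) : barker L v x ∈ Set.Icc (0 : ℝ) 1 :=
  ⟨Real.sigmoid_nonneg _, Real.sigmoid_le_one _⟩

lemma measurable_barker {L : (P → ℝ) → ℝ} (hL : Measurable L) (v : P → ℝ) :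
    Measurable (barker L v) :=
  continuous_sigmoid.measurable.comp ((hL.comp (measurable_add_const v)).sub hL)

lemma exp_mul_sigmoid_sub (a b : ℝ) :
    Real.exp a * Real.sigmoid (b - a) = Real.exp b * Real.sigmoid (a - b) := by
  have h := Real.sigmoid_mul_rexp_neg (a - b)
  rw [neg_sub] at h
  rw [← h, mul_comm (Real.sigmoid _), ← mul_assoc, ← Real.exp_add]
  ring_nf

lemma stepVec_not [DecidableEq P] (s : ℝ) (i : P × Bool) : stepVec s (i.1, !i.2) = -stepVec s i := by
  rcases i with ⟨p, b⟩
  cases b <;> simp [stepVec, Pi.single_neg]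

lemma lintegral_barker_move [Fintype P] {L : (P → ℝ) → ℝ} (hL : Measurable L) (v : P → ℝ)
    {f : (P → ℝ) → ℝ≥0∞} (hf : Measurable f) :
    ∫⁻ x, ENNReal.ofReal (barker L v x) * f (x + v)
      ∂volume.withDensity (fun x => ENNReal.ofReal (Real.exp (L x))) =
    ∫⁻ x, ENNReal.ofReal (barker L (-v) x) * f x
      ∂volume.withDensity (fun x => ENNReal.ofReal (Real.exp (L x))) := by
  have hd : Measurable fun x => ENNReal.ofReal (Real.exp (L x)) := hL.exp.ennreal_ofReal
  have m1 : Measurable fun x => ENNReal.ofReal (barker L v x) * f (x + v) :=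
    (measurable_barker hL v).ennreal_ofReal.mul (hf.comp (measurable_add_const _))
  have m2 : Measurable fun x => ENNReal.ofReal (barker L (-v) x) * f x :=
    (measurable_barker hL _).ennreal_ofReal.mul hf
  rw [lintegral_withDensity_eq_lintegral_mul _ hd m1,
    lintegral_withDensity_eq_lintegral_mul _ hd m2,
    ← lintegral_add_right_eq_self _ v]
  conv_rhs => rw [← lintegral_add_right_eq_self _ v]
  conv_lhs => rw [lintegral_add_right_eq_self _ v]
  refine lintegral_congr fun x => ?_
  simp only [Pi.mul_apply, ← mul_assoc, barker, add_neg_cancel_right]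
  rw [← ENNReal.ofReal_mul (Real.exp_pos _).le, ← ENNReal.ofReal_mul (Real.exp_pos _).le,
    exp_mul_sigmoid_sub]

lemma invariantUnder_barker [Fintype P] [DecidableEq P] {L : (P → ℝ) → ℝ} (hL : Measurable L) (k : ℝ≥0∞) (s : ℝ) :
    InvariantUnder (k • volume.withDensity (fun x => ENNReal.ofReal (Real.exp (L x))))
      (fun i : P × Bool => barker L (stepVec s i)) (stepVec s) := by
  intro f hf
  simp only [lintegral_smul_measure, smul_eq_mul, ← Finset.mul_sum]
  rw [mul_left_comm]
  congr 1
  set μ := volume.withDensity (fun x => ENNReal.ofReal (Real.exp (L x)))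
  have m1 : ∀ i : P × Bool, Measurable fun x => ENNReal.ofReal (barker L (stepVec s i) x) * f x :=
    fun i => (measurable_barker hL _).ennreal_ofReal.mul hf
  have m2 : ∀ i : P × Bool,
      Measurable fun x => ENNReal.ofReal (1 - barker L (stepVec s i) x) * f x :=
    fun i => (measurable_const.sub (measurable_barker hL _)).ennreal_ofReal.mul hf
  have e : ∀ i : P × Bool, ∫⁻ x, (ENNReal.ofReal (barker L (stepVec s i) x) * f (x + stepVec s i) +
      ENNReal.ofReal (1 - barker L (stepVec s i) x) * f x) ∂μ =
      ∫⁻ x, ENNReal.ofReal (barker L (stepVec s (i.1, !i.2)) x) * f x ∂μ +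
      ∫⁻ x, ENNReal.ofReal (1 - barker L (stepVec s i) x) * f x ∂μ := fun i => by
    rw [lintegral_add_right _ (m2 i), lintegral_barker_move hL _ hf, stepVec_not]
  have e2 : ∀ i : P × Bool, ∫⁻ x, ENNReal.ofReal (barker L (stepVec s i) x) * f x ∂μ +
      ∫⁻ x, ENNReal.ofReal (1 - barker L (stepVec s i) x) * f x ∂μ = ∫⁻ x, f x ∂μ := fun i => by
    rw [← lintegral_add_right _ (m2 i)]
    refine lintegral_congr fun x => ?_
    have h := barker_mem_Icc L (stepVec s i) x
    rw [← add_mul, ← ENNReal.ofReal_add h.1 (sub_nonneg.2 h.2)]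
    simp
  rw [Finset.sum_congr rfl fun i _ => e i, Finset.sum_add_distrib,
    Fintype.sum_bijective (fun i : P × Bool => (i.1, !i.2))
      (Function.Involutive.bijective fun i => by simp) _
      (fun i : P × Bool => ∫⁻ x, ENNReal.ofReal (barker L (stepVec s i) x) * f x ∂μ)
      (fun i => rfl), ← Finset.sum_add_distrib, Finset.sum_congr rfl fun i _ => e2 i]
  simp

end Barker

section Pointwise

variable {P B : Type*} [Fintype P] [DecidableEq B] (blk : P → B)

/-- Euclidean norm of the block `j` of a vector. -/
def blkNorm (j : B) (z : P → ℝ) : ℝ := √(∑ p with blk p = j, z p ^ 2)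

/-- Smooth regularization of `blkNorm`. -/
def regNorm (η : ℝ) (j : B) (z : P → ℝ) : ℝ := √(∑ p with blk p = j, z p ^ 2 + η ^ 2)

/-- Deviation of acceptance probabilities from their small step asymptotics with score `b`. -/
def stepErr (s η : ℝ) (α : P × Bool → ℝ) (b : P → ℝ) : ℝ :=
  ∑ p, (|2 / s * (α (p, true) - α (p, false)) - b p| +
    (|α (p, true) - 1 / 2| + |α (p, false) - 1 / 2|) / η)

lemma blkNorm_nonneg (j : B) (z : P → ℝ) : 0 ≤ blkNorm blk j z := Real.sqrt_nonneg _

lemma sq_blkNorm (j : B) (z : P → ℝ) : blkNorm blk j z ^ 2 = ∑ p with blk p = j, z p ^ 2 :=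
  Real.sq_sqrt (Finset.sum_nonneg fun _ _ => sq_nonneg _)

lemma sq_regNorm (η : ℝ) (j : B) (z : P → ℝ) :
    regNorm blk η j z ^ 2 = blkNorm blk j z ^ 2 + η ^ 2 := by
  rw [sq_blkNorm, regNorm, Real.sq_sqrt]
  exact add_nonneg (Finset.sum_nonneg fun _ _ => sq_nonneg _) (sq_nonneg _)

lemma blkNorm_le_regNorm (η : ℝ) (j : B) (z : P → ℝ) : blkNorm blk j z ≤ regNorm blk η j z :=
  Real.sqrt_le_sqrt (le_add_of_nonneg_right (sq_nonneg _))

lemma le_regNorm (η : ℝ) (j : B) (z : P → ℝ) : η ≤ regNorm blk η j z :=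
  Real.le_sqrt_of_sq_le (le_add_of_nonneg_left (Finset.sum_nonneg fun _ _ => sq_nonneg _))

lemma abs_le_blkNorm (z : P → ℝ) (p : P) : |z p| ≤ blkNorm blk (blk p) z := by
  refine Real.abs_le_sqrt ?_
  exact Finset.single_le_sum (f := fun p => z p ^ 2) (fun _ _ => sq_nonneg _) (by simp)

lemma sum_mul_le_blkNorm (j : B) (z w : P → ℝ) :
    ∑ p with blk p = j, z p * w p ≤ blkNorm blk j z * blkNorm blk j w :=
  Real.sum_mul_le_sqrt_mul_sqrt _ _ _

lemma regNorm_add_single [DecidableEq P] {η : ℝ} (hη : 0 < η) (j : B) (z : P → ℝ) (p : P) (t : ℝ) :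
    regNorm blk η j (z + Pi.single p t) - regNorm blk η j z ≤
      if blk p = j then t * z p / regNorm blk η j z + t ^ 2 / (2 * η) else 0 := by
  have hr := le_regNorm blk η j z
  have hr0 : 0 < regNorm blk η j z := hη.trans_le hr
  split_ifs with h
  · have e : regNorm blk η j (z + Pi.single p t) ^ 2 =
        regNorm blk η j z ^ 2 + (2 * t * z p + t ^ 2) := by
      rw [sq_regNorm, sq_regNorm, sq_blkNorm, sq_blkNorm]
      have hp : p ∈ Finset.univ.filter fun q => blk q = j := by simpa using h
      rw [← Finset.add_sum_erase _ _ hp, ← Finset.add_sum_erase _ (fun q => z q ^ 2) hp]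
      have : ∑ q ∈ (Finset.univ.filter fun q => blk q = j).erase p, (z + (Pi.single p t : P → ℝ)) q ^ 2 =
          ∑ q ∈ (Finset.univ.filter fun q => blk q = j).erase p, z q ^ 2 :=
        Finset.sum_congr rfl fun q hq => by simp [Finset.ne_of_mem_erase hq]
      rw [this]
      simp only [Pi.add_apply, Pi.single_eq_same]
      ring
    have h1 : regNorm blk η j (z + Pi.single p t) - regNorm blk η j z ≤
        (2 * t * z p + t ^ 2) / (2 * regNorm blk η j z) := by
      rw [le_div_iff₀ (by positivity)]
      nlinarith [sq_nonneg (regNorm blk η j (z + Pi.single p t) - regNorm blk η j z)]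
    have h2 : t ^ 2 / (2 * regNorm blk η j z) ≤ t ^ 2 / (2 * η) := by gcongr
    have h3 : (2 * t * z p + t ^ 2) / (2 * regNorm blk η j z) =
        t * z p / regNorm blk η j z + t ^ 2 / (2 * regNorm blk η j z) := by
      field_simp
    linarith
  · refine le_of_eq (sub_eq_zero.2 ?_)
    unfold regNorm
    congr 2
    refine Finset.sum_congr rfl fun q hq => ?_
    have : q ≠ p := by rintro rfl; simp at hq; exact h hq
    simp [this]

lemma sum_move_le [DecidableEq P] {s η : ℝ} (hs : 0 < s) (hη : 0 < η) (j : B) (α β : P × Bool → ℝ)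
    (z b b' b'' : P → ℝ) :
    ∑ i, ((α i - min (α i) (β i)) *
        (regNorm blk η j (z + stepVec s i) - regNorm blk η j z) +
      (β i - min (α i) (β i)) * (regNorm blk η j (z - stepVec s i) - regNorm blk η j z)) ≤
    s ^ 2 / 2 * (stepErr s η α b + stepErr s η β b'' + blkNorm blk j (b - b') +
      (∑ p with blk p = j, z p * (b' p - b'' p)) / regNorm blk η j z) := by
  set r := regNorm blk η j z with hrdef
  have hr : η ≤ r := le_regNorm blk η j z
  have hr0 : 0 < r := hη.trans_le hr
  have move : ∀ i : P × Bool, ∀ t : ℝ, stepVec s i = Pi.single i.1 t → t ^ 2 = s ^ 2 →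
      (α i - min (α i) (β i)) * (regNorm blk η j (z + stepVec s i) - r) +
      (β i - min (α i) (β i)) * (regNorm blk η j (z - stepVec s i) - r) ≤
      if blk i.1 = j then
        (α i - β i) * (t * z i.1 / r) + |α i - β i| * (s ^ 2 / (2 * η)) else 0 := by
    intro i t ht hts
    have h1 := regNorm_add_single blk hη j z i.1 t
    have h2 := regNorm_add_single blk hη j z i.1 (-t)
    rw [Pi.single_neg, ← ht, ← sub_eq_add_neg] at h2
    rw [← ht] at h1
    have k1 := mul_le_mul_of_nonneg_left h1 (sub_nonneg.2 (min_le_left (α i) (β i)))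
    have k2 := mul_le_mul_of_nonneg_left h2 (sub_nonneg.2 (min_le_right (α i) (β i)))
    refine (add_le_add k1 k2).trans (le_of_eq ?_)
    split_ifs
    · have e : |α i - β i| = α i + β i - 2 * min (α i) (β i) := by
        rcases le_total (α i) (β i) with h | h
        · rw [min_eq_left h, abs_of_nonpos (by linarith)]; ring
        · rw [min_eq_right h, abs_of_nonneg (by linarith)]; ring
      rw [e, neg_sq, hts]
      ring
    · simp
  have hpix : ∀ p ∈ Finset.univ.filter fun p => blk p = j,
      ((α (p, true) - β (p, true)) * (s * z p / r) +
        |α (p, true) - β (p, true)| * (s ^ 2 / (2 * η)) +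
      ((α (p, false) - β (p, false)) * (-s * z p / r) +
        |α (p, false) - β (p, false)| * (s ^ 2 / (2 * η)))) ≤
      s ^ 2 / 2 * ((|2 / s * (α (p, true) - α (p, false)) - b p| +
          (|α (p, true) - 1 / 2| + |α (p, false) - 1 / 2|) / η) +
        (|2 / s * (β (p, true) - β (p, false)) - b'' p| +
          (|β (p, true) - 1 / 2| + |β (p, false) - 1 / 2|) / η) +
        z p / r * (b p - b' p) + z p * (b' p - b'' p) / r) := by
    intro p hp
    have hj : blk p = j := by simpa using hp
    have hz : |z p / r| ≤ 1 := by
      rw [abs_div, abs_of_pos hr0, div_le_one hr0]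
      have := abs_le_blkNorm blk z p
      rw [hj] at this
      exact this.trans (blkNorm_le_regNorm blk η j z)
    have t1 : |α (p, true) - β (p, true)| ≤ |α (p, true) - 1 / 2| + |β (p, true) - 1 / 2| := by
      rw [abs_sub_comm (β (p, true))]; exact abs_sub_le _ _ _
    have t2 : |α (p, false) - β (p, false)| ≤
        |α (p, false) - 1 / 2| + |β (p, false) - 1 / 2| := by
      rw [abs_sub_comm (β (p, false))]; exact abs_sub_le _ _ _
    have w : ∀ u : ℝ, z p / r * u ≤ |u| := fun u => by
      refine (le_abs_self _).trans ?_
      rw [abs_mul]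
      exact mul_le_of_le_one_left (abs_nonneg _) hz
    have w1 := w (2 / s * (α (p, true) - α (p, false)) - b p)
    have w2 := w (-(2 / s * (β (p, true) - β (p, false)) - b'' p))
    rw [abs_neg] at w2
    have q1 : |α (p, true) - β (p, true)| / η ≤
        (|α (p, true) - 1 / 2| + |β (p, true) - 1 / 2|) / η := by gcongr
    have q2 : |α (p, false) - β (p, false)| / η ≤
        (|α (p, false) - 1 / 2| + |β (p, false) - 1 / 2|) / η := by gcongr
    have hs2 : 0 ≤ s ^ 2 / 2 := by positivity
    have e1 : ((α (p, true) - β (p, true)) * (s * z p / r) +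
        |α (p, true) - β (p, true)| * (s ^ 2 / (2 * η)) +
      ((α (p, false) - β (p, false)) * (-s * z p / r) +
        |α (p, false) - β (p, false)| * (s ^ 2 / (2 * η)))) =
      s ^ 2 / 2 * (z p / r * (2 / s * (α (p, true) - α (p, false)) - b p) +
        z p / r * (-(2 / s * (β (p, true) - β (p, false)) - b'' p)) +
        |α (p, true) - β (p, true)| / η + |α (p, false) - β (p, false)| / η +
        z p / r * (b p - b' p) + z p * (b' p - b'' p) / r) := by
      field_simp
      ring
    rw [e1]
    refine mul_le_mul_of_nonneg_left ?_ hs2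
    rw [add_div] at q1 q2 ⊢
    rw [add_div]
    linarith
  have herr : ∀ (α : P × Bool → ℝ) (b : P → ℝ), ∑ p with blk p = j,
      (|2 / s * (α (p, true) - α (p, false)) - b p| +
        (|α (p, true) - 1 / 2| + |α (p, false) - 1 / 2|) / η) ≤ stepErr s η α b := fun α b =>
    Finset.sum_le_sum_of_subset_of_nonneg (Finset.filter_subset _ _)
      fun _ _ _ => by positivity
  have hcs : ∑ p with blk p = j, z p / r * (b p - b' p) ≤ blkNorm blk j (b - b') := by
    have h1 := sum_mul_le_blkNorm blk j z (b - b')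
    have h2 : ∑ p with blk p = j, z p / r * (b p - b' p) =
        (∑ p with blk p = j, z p * (b - b') p) / r := by
      rw [Finset.sum_div]
      exact Finset.sum_congr rfl fun p _ => by simp only [Pi.sub_apply]; ring
    rw [h2, div_le_iff₀ hr0, mul_comm]
    refine h1.trans (mul_le_mul_of_nonneg_right (blkNorm_le_regNorm blk η j z)
      (blkNorm_nonneg _ _ _))
  rw [Fintype.sum_prod_type]
  simp only [Fintype.sum_bool]
  calc _ ≤ ∑ p, ((if blk p = j then (α (p, true) - β (p, true)) * (s * z p / r) +
        |α (p, true) - β (p, true)| * (s ^ 2 / (2 * η)) else 0) +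
      (if blk p = j then (α (p, false) - β (p, false)) * (-s * z p / r) +
        |α (p, false) - β (p, false)| * (s ^ 2 / (2 * η)) else 0)) :=
        Finset.sum_le_sum fun p _ => add_le_add (move (p, true) s (by simp [stepVec]) rfl)
          (move (p, false) (-s) (by simp [stepVec]) (neg_sq s))
    _ = ∑ p with blk p = j, ((α (p, true) - β (p, true)) * (s * z p / r) +
        |α (p, true) - β (p, true)| * (s ^ 2 / (2 * η)) +
      ((α (p, false) - β (p, false)) * (-s * z p / r) +
        |α (p, false) - β (p, false)| * (s ^ 2 / (2 * η)))) := by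
        rw [Finset.sum_filter]
        exact Finset.sum_congr rfl fun p _ => by split_ifs <;> simp
    _ ≤ _ := Finset.sum_le_sum hpix
    _ ≤ _ := by
        rw [← Finset.mul_sum]
        refine mul_le_mul_of_nonneg_left ?_ (by positivity)
        have split : ∀ f g h k : P → ℝ, ∑ p with blk p = j, (f p + g p + h p + k p) =
            ∑ p with blk p = j, f p + ∑ p with blk p = j, g p + ∑ p with blk p = j, h p +
              ∑ p with blk p = j, k p := fun f g h k => by simp only [Finset.sum_add_distrib]
        rw [Finset.sum_div, split]
        linarith [herr α b, herr β b'']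

lemma drift_div_le [Fintype B] {η : ℝ} (hη : 0 < η) (j : B) (z : P → ℝ) {a d : ℝ} {K : B → ℝ}
    (ha : 0 ≤ a) (hK : ∀ k, 0 ≤ K k)
    (hd : d ≤ blkNorm blk j z * (-a * blkNorm blk j z + ∑ k, K k * blkNorm blk k z)) :
    d / regNorm blk η j z ≤ -a * (regNorm blk η j z - η) + ∑ k, K k * regNorm blk η k z := by
  have hr := le_regNorm blk η j z
  have hr0 : 0 < regNorm blk η j z := hη.trans_le hr
  have hs : ∑ k, K k * blkNorm blk k z ≤ ∑ k, K k * regNorm blk η k z :=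
    Finset.sum_le_sum fun k _ => mul_le_mul_of_nonneg_left (blkNorm_le_regNorm _ _ _ _) (hK k)
  have hs0 : 0 ≤ ∑ k, K k * blkNorm blk k z :=
    Finset.sum_nonneg fun k _ => mul_nonneg (hK k) (blkNorm_nonneg _ _ _)
  rw [div_le_iff₀ hr0]
  have h1 : blkNorm blk j z * ∑ k, K k * blkNorm blk k z ≤
      regNorm blk η j z * ∑ k, K k * regNorm blk η k z :=
    mul_le_mul (blkNorm_le_regNorm _ _ _ _) hs hs0 hr0.le
  have h2 : a * (regNorm blk η j z * (regNorm blk η j z - η)) ≤ a * blkNorm blk j z ^ 2 := by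
    refine mul_le_mul_of_nonneg_left ?_ ha
    nlinarith [sq_regNorm blk η j z]
  nlinarith

end Pointwise

section StepError

variable {P : Type*} [Fintype P] [DecidableEq P]

/-- Regularity of a log-density `L` and integrability with respect to `μ` that are needed for the
small step asymptotics of the Barker chain. -/
structure TameLogDensity (L : (P → ℝ) → ℝ) (μ : Measure (P → ℝ)) : Prop where
  continuous : Continuous L
  ae_differentiableAt : ∀ᵐ x ∂μ, DifferentiableAt ℝ L x
  growth : ∃ C : ℝ, ∀ (x : P → ℝ) (p : P) (s : ℝ), 0 < s → s ≤ 1 →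
    |L (x + Pi.single p s) - L (x + Pi.single p (-s))| ≤ s * (C * (1 + ‖x‖))
  integrable_norm : Integrable (fun x => ‖x‖) μ

/-- The partial derivatives of `L`. -/
def score (L : (P → ℝ) → ℝ) (x : P → ℝ) (p : P) : ℝ := fderiv ℝ L x (Pi.single p 1)

/-- The error `stepErr` of the Barker chain at the point `x`. -/
def barkerErr (L : (P → ℝ) → ℝ) (s η : ℝ) (x : P → ℝ) : ℝ :=
  stepErr s η (fun i => barker L (stepVec s i) x) (score L x)

lemma abs_sigmoid_sub_le (a b : ℝ) : |Real.sigmoid a - Real.sigmoid b| ≤ |a - b| := by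
  have h : LipschitzWith 1 Real.sigmoid := by
    refine lipschitzWith_of_nnnorm_deriv_le differentiable_sigmoid fun x => ?_
    rw [← NNReal.coe_le_coe, coe_nnnorm, Real.deriv_sigmoid, NNReal.coe_one, Real.norm_eq_abs,
      abs_of_nonneg (mul_nonneg (Real.sigmoid_nonneg x) (sub_nonneg.2 (Real.sigmoid_le_one x)))]
    nlinarith [Real.sigmoid_nonneg x, Real.sigmoid_le_one x]
  simpa [Real.dist_eq] using h.dist_le_mul a b

lemma measurable_score {L : (P → ℝ) → ℝ} (p : P) : Measurable fun x => score L x p :=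
  measurable_fderiv_apply_const ℝ L _

lemma measurable_barkerErr {L : (P → ℝ) → ℝ} (hL : Measurable L) (s η : ℝ) :
    Measurable (barkerErr L s η) := by
  unfold barkerErr stepErr
  have h1 : ∀ i : P × Bool, Measurable fun x => barker L (stepVec s i) x :=
    fun i => measurable_barker hL _
  have h2 : ∀ p, Measurable fun x => score L x p := measurable_score
  have habs : ∀ f : (P → ℝ) → ℝ, Measurable f → Measurable fun x => |f x| :=
    fun f hf => continuous_abs.measurable.comp hf
  refine Finset.measurable_sum _ fun p _ => ?_
  refine (habs _ (((((h1 _).sub (h1 _))).const_mul _).sub (h2 p))).add ?_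
  exact ((habs _ ((h1 _).sub_const _)).add (habs _ ((h1 _).sub_const _))).div_const _

lemma tendsto_barker_slope {L : (P → ℝ) → ℝ} {x : P → ℝ} (h : DifferentiableAt ℝ L x) (p : P) :
    Filter.Tendsto (fun s => 2 / s * (barker L (stepVec s (p, true)) x -
      barker L (stepVec s (p, false)) x)) (nhdsWithin 0 (Set.Ioi 0)) (nhds (score L x p)) := by
  have hline : HasDerivAt (fun t : ℝ => x + t • (Pi.single p (1 : ℝ) : P → ℝ))
      (Pi.single p 1) 0 := by
    simpa using ((hasDerivAt_id (0 : ℝ)).smul_const (Pi.single p (1 : ℝ) : P → ℝ)).const_add x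
  have hL : HasDerivAt (fun t : ℝ => L (x + t • (Pi.single p (1 : ℝ) : P → ℝ)) - L x)
      (score L x p) 0 := by
    have hf : HasFDerivAt L (fderiv ℝ L x) (x + (0 : ℝ) • (Pi.single p (1 : ℝ) : P → ℝ)) := by
      simpa using h.hasFDerivAt
    exact (hf.comp_hasDerivAt (0 : ℝ) hline).sub_const _
  have hs : HasDerivAt (fun t : ℝ =>
      Real.sigmoid (L (x + t • (Pi.single p (1 : ℝ) : P → ℝ)) - L x)) (score L x p / 4) 0 := by
    have := (Real.hasDerivAt_sigmoid
      (L (x + (0 : ℝ) • (Pi.single p (1 : ℝ) : P → ℝ)) - L x)).comp (0 : ℝ) hL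
    have e : Real.sigmoid (L (x + (0 : ℝ) • (Pi.single p (1 : ℝ) : P → ℝ)) - L x) *
        (1 - Real.sigmoid (L (x + (0 : ℝ) • (Pi.single p (1 : ℝ) : P → ℝ)) - L x)) *
        score L x p = score L x p / 4 := by
      simp only [zero_smul, add_zero, sub_self, Real.sigmoid_zero]
      ring
    rw [e] at this
    exact this
  have hneg : HasDerivAt (fun t : ℝ =>
      Real.sigmoid (L (x + (-t) • (Pi.single p (1 : ℝ) : P → ℝ)) - L x)) (-(score L x p / 4)) 0 := by
    have h0 : HasDerivAt (fun t : ℝ =>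
      Real.sigmoid (L (x + t • (Pi.single p (1 : ℝ) : P → ℝ)) - L x)) (score L x p / 4) (-0) := by
      simpa using hs
    have h1 := h0.comp (0 : ℝ) (hasDerivAt_neg (0 : ℝ))
    rw [mul_neg_one] at h1
    exact h1
  have hd := (hasDerivAt_iff_tendsto_slope_zero.1 (hs.sub hneg)).mono_left
    (nhdsWithin_mono 0 fun t (ht : 0 < t) => ht.ne')
  have hd2 := hd.const_mul 2
  have e : 2 * (score L x p / 4 - -(score L x p / 4)) = score L x p := by ring
  rw [e] at hd2
  refine hd2.congr fun t => ?_
  have h1 : (t • (Pi.single p (1 : ℝ) : P → ℝ)) = Pi.single p t := by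
    rw [← Pi.single_smul]; simp
  have h2 : ((-t) • (Pi.single p (1 : ℝ) : P → ℝ)) = Pi.single p (-t) := by
    rw [← Pi.single_smul]; simp
  simp only [barker, stepVec, Pi.sub_apply, zero_add, neg_zero, zero_smul, sub_self, smul_eq_mul,
    if_true, Bool.false_eq_true, if_false, h1, h2, sub_zero]
  ring

lemma abs_barker_slope_le {Q : Type*} [DecidableEq Q] {L : (Q → ℝ) → ℝ} {x : Q → ℝ} {p : Q}
    {s K : ℝ} (hs : 0 < s)
    (h : |L (x + Pi.single p s) - L (x + Pi.single p (-s))| ≤ s * K) :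
    |2 / s * (barker L (stepVec s (p, true)) x - barker L (stepVec s (p, false)) x)| ≤ 2 * K := by
  have h1 : |barker L (stepVec s (p, true)) x - barker L (stepVec s (p, false)) x| ≤ s * K := by
    refine (abs_sigmoid_sub_le _ _).trans ?_
    simpa [stepVec] using h
  rw [abs_mul, abs_of_pos (by positivity)]
  calc 2 / s * |barker L (stepVec s (p, true)) x - barker L (stepVec s (p, false)) x| ≤
      2 / s * (s * K) := by gcongr
    _ = 2 * K := by field_simp

lemma abs_score_le {L : (P → ℝ) → ℝ} {x : P → ℝ} {p : P} {K : ℝ} (hd : DifferentiableAt ℝ L x)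
    (h : ∀ s, 0 < s → s ≤ 1 → |L (x + Pi.single p s) - L (x + Pi.single p (-s))| ≤ s * K) :
    |score L x p| ≤ 2 * K := by
  refine le_of_tendsto (tendsto_barker_slope hd p).abs ?_
  filter_upwards [Ioc_mem_nhdsGT (zero_lt_one' ℝ)] with s hs
  exact abs_barker_slope_le hs.1 (h s hs.1 hs.2)

lemma barkerErr_nonneg (L : (P → ℝ) → ℝ) (s : ℝ) {η : ℝ} (hη : 0 < η) (x : P → ℝ) :
    0 ≤ barkerErr L s η x :=
  Finset.sum_nonneg fun _ _ => by positivity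

lemma barkerErr_le {L : (P → ℝ) → ℝ} {x : P → ℝ} {s η K : ℝ} (hs : 0 < s) (hs1 : s ≤ 1)
    (hη : 0 < η) (hd : DifferentiableAt ℝ L x)
    (h : ∀ p s, 0 < s → s ≤ 1 → |L (x + Pi.single p s) - L (x + Pi.single p (-s))| ≤ s * K) :
    barkerErr L s η x ≤ Fintype.card P * (4 * K + 1 / η) := by
  have hh : ∀ i : P × Bool, |barker L (stepVec s i) x - 1 / 2| ≤ 1 / 2 := fun i => by
    have := barker_mem_Icc L (stepVec s i) x
    rw [abs_le]; constructor <;> linarith [this.1, this.2]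
  have : ∀ p ∈ Finset.univ, |2 / s * (barker L (stepVec s (p, true)) x -
      barker L (stepVec s (p, false)) x) - score L x p| +
      (|barker L (stepVec s (p, true)) x - 1 / 2| +
        |barker L (stepVec s (p, false)) x - 1 / 2|) / η ≤ 4 * K + 1 / η := by
    intro p _
    have h1 := abs_barker_slope_le hs (h p s hs hs1)
    have h2 := abs_score_le (p := p) hd (h p)
    have h3 := abs_sub (2 / s * (barker L (stepVec s (p, true)) x -
      barker L (stepVec s (p, false)) x)) (score L x p)
    have h4 : (|barker L (stepVec s (p, true)) x - 1 / 2| +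
        |barker L (stepVec s (p, false)) x - 1 / 2|) / η ≤ 1 / η := by
      gcongr
      linarith [hh (p, true), hh (p, false)]
    linarith
  refine (Finset.sum_le_sum this).trans ?_
  simp [mul_add]

variable {L : (P → ℝ) → ℝ} {μ : Measure (P → ℝ)} [IsFiniteMeasure μ]

lemma TameLogDensity.exists_bound (h : TameLogDensity L μ) {η : ℝ} (hη : 0 < η) :
    ∃ G : (P → ℝ) → ℝ, Integrable G μ ∧ ∀ s, 0 < s → s ≤ 1 →
      ∀ᵐ x ∂μ, ‖barkerErr L s η x‖ ≤ G x := by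
  obtain ⟨C, hC⟩ := h.growth
  refine ⟨fun x => Fintype.card P * (4 * (C * (1 + ‖x‖)) + 1 / η), ?_, fun s hs hs1 => ?_⟩
  · have h0 := h.integrable_norm
    exact ((((integrable_const 1).add h0).const_mul C).const_mul 4).add (integrable_const (1 / η))
      |>.const_mul _
  · filter_upwards [h.ae_differentiableAt] with x hx
    rw [Real.norm_of_nonneg (barkerErr_nonneg L s hη x)]
    exact barkerErr_le hs hs1 hη hx fun p s => hC x p s

lemma TameLogDensity.integrable_barkerErr (h : TameLogDensity L μ) {s η : ℝ} (hs : 0 < s)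
    (hs1 : s ≤ 1) (hη : 0 < η) : Integrable (barkerErr L s η) μ := by
  obtain ⟨G, hG, hb⟩ := h.exists_bound hη
  exact hG.mono' (measurable_barkerErr h.continuous.measurable s η).aestronglyMeasurable
    (hb s hs hs1)

lemma TameLogDensity.integrable_score (h : TameLogDensity L μ) (p : P) :
    Integrable (fun x => score L x p) μ := by
  obtain ⟨C, hC⟩ := h.growth
  have h0 := h.integrable_norm
  refine Integrable.mono' ((((integrable_const 1).add h0).const_mul C).const_mul 2)
    (measurable_score p).aestronglyMeasurable ?_
  filter_upwards [h.ae_differentiableAt] with x hx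
  exact abs_score_le hx (hC x p)

lemma TameLogDensity.tendsto_integral_barkerErr (h : TameLogDensity L μ) {η : ℝ} (hη : 0 < η) :
    Filter.Tendsto (fun s => ∫ x, barkerErr L s η x ∂μ) (nhdsWithin 0 (Set.Ioi 0)) (nhds 0) := by
  obtain ⟨G, hG, hb⟩ := h.exists_bound hη
  rw [show nhds (0 : ℝ) = nhds (∫ _, (0 : ℝ) ∂μ) by simp]
  refine tendsto_integral_filter_of_dominated_convergence G
    (Filter.Eventually.of_forall fun s =>
      (measurable_barkerErr h.continuous.measurable s η).aestronglyMeasurable) ?_ hG ?_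
  · filter_upwards [Ioc_mem_nhdsGT (zero_lt_one' ℝ)] with s hs using hb s hs.1 hs.2
  · filter_upwards [h.ae_differentiableAt] with x hx
    have hhalf : ∀ (p : P) (b : Bool), Filter.Tendsto (fun s => barker L (stepVec s (p, b)) x)
        (nhdsWithin 0 (Set.Ioi 0)) (nhds (1 / 2)) := by
      intro p b
      have hv : Continuous fun s : ℝ => stepVec s (p, b) := by
        refine (continuous_single p).comp ?_
        cases b <;> simp <;> fun_prop
      have hc : Continuous fun s : ℝ => barker L (stepVec s (p, b)) x :=
        continuous_sigmoid.comp
          ((h.continuous.comp (continuous_const.add hv)).sub continuous_const)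
      have h0 : barker L (stepVec 0 (p, b)) x = 1 / 2 := by
        simp [barker, stepVec, Real.sigmoid_zero]
      have := hc.tendsto 0
      rw [h0] at this
      exact this.mono_left nhdsWithin_le_nhds
    rw [show nhds (0 : ℝ) = nhds (∑ p : P, (|score L x p - score L x p| +
        (|(1 / 2 : ℝ) - 1 / 2| + |(1 / 2 : ℝ) - 1 / 2|) / η)) by simp]
    refine tendsto_finsetSum _ fun p _ => ?_
    exact (((tendsto_barker_slope hx p).sub_const _).abs).add
      (((((hhalf p true).sub_const _).abs).add (((hhalf p false).sub_const _).abs)).div_const η)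

end StepError

lemma exists_le_of_contraction {S : Set ℝ} (hS : S.Nonempty) (hb : BddBelow S) {θ q e : ℝ}
    (hθ : 0 < θ) (he : 0 < e) (h : ∀ t ∈ S, t - θ * (t - q) ∈ S) : ∃ t ∈ S, t ≤ q + e := by
  by_contra! hc
  obtain ⟨t, ht, hlt⟩ := exists_lt_of_csInf_lt hS (lt_add_of_pos_right (sInf S) (mul_pos hθ he))
  have h1 := csInf_le hb (h t ht)
  have h2 := mul_lt_mul_of_pos_left (hc t ht) hθ
  linarith

section Contraction

variable {P B : Type*} [Fintype P] [DecidableEq B] (blk : P → B)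

lemma continuous_regNorm (η : ℝ) (j : B) : Continuous (regNorm blk η j) := by
  unfold regNorm
  fun_prop

lemma continuous_blkNorm (j : B) : Continuous (blkNorm blk j) := by
  unfold blkNorm
  fun_prop

lemma regNorm_le {η : ℝ} (hη : 0 ≤ η) (j : B) (z : P → ℝ) :
    regNorm blk η j z ≤ Fintype.card P * ‖z‖ + η := by
  refine Real.sqrt_le_iff.2 ⟨by positivity, ?_⟩
  have h1 : ∑ p with blk p = j, z p ^ 2 ≤ ∑ _p : P, ‖z‖ ^ 2 :=
    (Finset.sum_le_sum_of_subset_of_nonneg (Finset.filter_subset _ _)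
      fun _ _ _ => sq_nonneg _).trans (Finset.sum_le_sum fun p _ => by
        rw [← sq_abs]
        exact pow_le_pow_left₀ (abs_nonneg _) (norm_le_pi_norm z p) 2)
  rw [Finset.sum_const, Finset.card_univ, nsmul_eq_mul] at h1
  have h2 : (Fintype.card P : ℝ) ≤ (Fintype.card P : ℝ) ^ 2 := by
    exact_mod_cast Nat.le_self_pow two_ne_zero _
  nlinarith [mul_le_mul_of_nonneg_right h2 (sq_nonneg ‖z‖),
    mul_nonneg (mul_nonneg (Nat.cast_nonneg (α := ℝ) (Fintype.card P)) (norm_nonneg z)) hη]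

lemma integrable_regNorm_sub {γ : Measure ((P → ℝ) × (P → ℝ))} [IsFiniteMeasure γ]
    (h1 : Integrable (fun z => ‖z.1‖) γ) (h2 : Integrable (fun z => ‖z.2‖) γ) {η : ℝ}
    (hη : 0 ≤ η) (j : B) (u w : P → ℝ) :
    Integrable (fun z => regNorm blk η j (z.1 + u - (z.2 + w))) γ := by
  refine Integrable.mono' (g := fun z =>
    Fintype.card P * (‖z.1‖ + ‖u‖ + (‖z.2‖ + ‖w‖)) + η) ?_ ?_ ?_
  · exact (((h1.add (integrable_const _)).add (h2.add (integrable_const _))).const_mul _).add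
      (integrable_const _)
  · exact ((continuous_regNorm blk η j).comp (by fun_prop)).aestronglyMeasurable
  · refine Filter.Eventually.of_forall fun z => ?_
    rw [Real.norm_of_nonneg (show 0 ≤ regNorm blk η j _ from Real.sqrt_nonneg _)]
    refine (regNorm_le blk hη j _).trans ?_
    gcongr
    exact (norm_sub_le _ _).trans (add_le_add (norm_add_le _ _) (norm_add_le _ _))

/-- `γ` is a coupling of `μ` and `ν`. -/
def IsCoupling {X Y : Type*} [MeasurableSpace X] [MeasurableSpace Y] (γ : Measure (X × Y))
    (μ : Measure X) (ν : Measure Y) : Prop :=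
  γ.map Prod.fst = μ ∧ γ.map Prod.snd = ν

variable [DecidableEq P]

/-- The unnormalized measure with log-density `L`, scaled by `k`. -/
def gibbs (L : (P → ℝ) → ℝ) (k : ℝ≥0∞) : Measure (P → ℝ) :=
  k • volume.withDensity (fun x => ENNReal.ofReal (Real.exp (L x)))

/-- Blockwise dissipativity of the score of `L`, with rates `a` and interactions `K`. -/
def BlockDissipative [Fintype B] (L : (P → ℝ) → ℝ) (a : B → ℝ) (K : B → B → ℝ) : Prop :=
  ∀ x y j, ∑ p with blk p = j, (x - y) p * (score L x p - score L y p) ≤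
    blkNorm blk j (x - y) *
      (-a j * blkNorm blk j (x - y) + ∑ k, K j k * blkNorm blk k (x - y))

variable {blk} {L₀ L₁ : (P → ℝ) → ℝ} {μ ν : Measure (P → ℝ)} {k₀ k₁ : ℝ≥0∞}
  [IsProbabilityMeasure μ] [IsProbabilityMeasure ν] {a : B → ℝ} {K : B → B → ℝ} {κ : ℝ}

lemma integrable_blkNorm_score_sub (h₀ : TameLogDensity L₀ μ)
    (h₁ : ∀ p, Integrable (fun x => score L₁ x p) μ) (j : B) :
    Integrable (fun x => blkNorm blk j (score L₀ x - score L₁ x)) μ := by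
  have hd : ∀ p, Integrable (fun x => |score L₀ x p - score L₁ x p|) μ :=
    fun p => ((h₀.integrable_score p).sub (h₁ p)).abs
  refine Integrable.mono' (integrable_finsetSum Finset.univ fun p _ => hd p) ?_ ?_
  · refine ((continuous_blkNorm blk j).measurable.comp ?_).aestronglyMeasurable
    exact measurable_pi_lambda _ fun p => (measurable_score p).sub (measurable_score p)
  · refine Filter.Eventually.of_forall fun x => ?_
    rw [Real.norm_of_nonneg (blkNorm_nonneg _ _ _)]
    refine Real.sqrt_le_iff.2 ⟨by positivity, ?_⟩
    refine (Finset.sum_le_sum_of_subset_of_nonneg (Finset.filter_subset _ _)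
      fun _ _ _ => sq_nonneg _).trans ?_
    have := Finset.sum_sq_le_sq_sum_of_nonneg (s := (Finset.univ : Finset P))
      (f := fun p => |score L₀ x p - score L₁ x p|) fun _ _ => abs_nonneg _
    simpa [sq_abs] using this

lemma exists_coupling_step [Nonempty P] [Fintype B] (hμ : μ = gibbs L₀ k₀) (hν : ν = gibbs L₁ k₁)
    (h₀ : TameLogDensity L₀ μ) (h₁ : TameLogDensity L₁ ν)
    (hint : ∀ p, Integrable (fun x => score L₁ x p) μ)
    (ha : ∀ j, 0 ≤ a j) (hK : ∀ j k, 0 ≤ K j k) (hsum : ∀ j, ∑ k, K j k + κ ≤ a j)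
    (hdis : BlockDissipative blk L₁ a K) {D : ℝ}
    (hD : ∀ j, ∫ x, blkNorm blk j (score L₀ x - score L₁ x) ∂μ ≤ D)
    {s η A T : ℝ} (hs : 0 < s) (hs1 : s ≤ 1) (hη : 0 < η) (hA : ∀ j, a j ≤ A)
    (hsA : s ^ 2 / (4 * Fintype.card P) * A ≤ 1)
    {γ : Measure ((P → ℝ) × (P → ℝ))} (hγ : IsCoupling γ μ ν)
    (hT : ∀ j, ∫ z, regNorm blk η j (z.1 - z.2) ∂γ ≤ T) :
    ∃ γ', IsCoupling γ' μ ν ∧ ∀ j, ∫ z, regNorm blk η j (z.1 - z.2) ∂γ' ≤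
      T - s ^ 2 / (4 * Fintype.card P) * (κ * T - (D +
        (∫ x, barkerErr L₀ s η x ∂μ + ∫ x, barkerErr L₁ s η x ∂ν) + A * η)) := by
  have hprob : IsProbabilityMeasure (γ.map Prod.fst) := by rw [hγ.1]; infer_instance
  have : IsProbabilityMeasure γ := Measure.isProbabilityMeasure_of_map Prod.fst
  have hm₀ : ∀ i : P × Bool, Measurable (barker L₀ (stepVec s i)) :=
    fun i => measurable_barker h₀.continuous.measurable _
  have hm₁ : ∀ i : P × Bool, Measurable (barker L₁ (stepVec s i)) :=
    fun i => measurable_barker h₁.continuous.measurable _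
  have hb₀ : ∀ (i : P × Bool) x, barker L₀ (stepVec s i) x ∈ Set.Icc (0 : ℝ) 1 :=
    fun i x => barker_mem_Icc _ _ _
  have hb₁ : ∀ (i : P × Bool) x, barker L₁ (stepVec s i) x ∈ Set.Icc (0 : ℝ) 1 :=
    fun i x => barker_mem_Icc _ _ _
  have fstI : ∀ f : (P → ℝ) → ℝ, Integrable f μ → Integrable (fun z => f z.1) γ := fun f hf => by
    rw [← hγ.1] at hf
    exact hf.comp_measurable measurable_fst
  have sndI : ∀ f : (P → ℝ) → ℝ, Integrable f ν → Integrable (fun z => f z.2) γ := fun f hf => by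
    rw [← hγ.2] at hf
    exact hf.comp_measurable measurable_snd
  have fstE : ∀ f : (P → ℝ) → ℝ, Integrable f μ → ∫ z, f z.1 ∂γ = ∫ x, f x ∂μ := fun f hf => by
    rw [← hγ.1] at hf ⊢
    exact (integral_map measurable_fst.aemeasurable hf.aestronglyMeasurable).symm
  have sndE : ∀ f : (P → ℝ) → ℝ, Integrable f ν → ∫ z, f z.2 ∂γ = ∫ x, f x ∂ν := fun f hf => by
    rw [← hγ.2] at hf ⊢
    exact (integral_map measurable_snd.aemeasurable hf.aestronglyMeasurable).symm
  have hR : ∀ (j : B) (u w : P → ℝ),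
      Integrable (fun z => regNorm blk η j (z.1 + u - (z.2 + w))) γ := fun j =>
    integrable_regNorm_sub blk (fstI _ h₀.integrable_norm) (sndI _ h₁.integrable_norm) hη.le j
  have hR0 : ∀ j, Integrable (fun z => regNorm blk η j (z.1 - z.2)) γ := fun j => by
    simpa using hR j 0 0
  refine ⟨coupledStep γ (fun i => barker L₀ (stepVec s i)) (fun i => barker L₁ (stepVec s i))
    (stepVec s), ⟨?_, ?_⟩, fun j => ?_⟩
  · rw [map_fst_coupledStep hm₀ hm₁ hb₀ hb₁, hγ.1]
    rw [hγ.1, hμ]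
    exact invariantUnder_barker h₀.continuous.measurable k₀ s
  · rw [map_snd_coupledStep hm₀ hm₁ hb₀ hb₁, hγ.2]
    rw [hγ.2, hν]
    exact invariantUnder_barker h₁.continuous.measurable k₁ s
  have hi1 : ∀ i : P × Bool, Integrable
      (fun z => regNorm blk η j (z.1 + stepVec s i - z.2)) γ := fun i => by
    simpa using hR j (stepVec s i) 0
  have hi2 : ∀ i : P × Bool, Integrable
      (fun z => regNorm blk η j (z.1 - (z.2 + stepVec s i))) γ := fun i => by
    simpa using hR j 0 (stepVec s i)
  rw [integral_coupledStep (F := fun z => regNorm blk η j (z.1 - z.2)) hm₀ hm₁ hb₀ hb₁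
    ((continuous_regNorm blk η j).comp (by fun_prop)).measurable (hR0 j) hi1 hi2
    (fun i x y => by simp)]
  have bdd : ∀ {w : (P → ℝ) × (P → ℝ) → ℝ} {G : (P → ℝ) × (P → ℝ) → ℝ}, Measurable w →
      (∀ z, w z ∈ Set.Icc (0 : ℝ) 1) → Integrable G γ → Integrable (fun z => w z * G z) γ :=
    fun hw hw0 hG => hG.bdd_mul (c := 1) hw.aestronglyMeasurable
      (Filter.Eventually.of_forall fun z => by
        rw [Real.norm_of_nonneg (hw0 z).1]; exact (hw0 z).2)
  have hint2 : ∀ i : P × Bool, Integrable (fun z =>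
      (barker L₀ (stepVec s i) z.1 -
          min (barker L₀ (stepVec s i) z.1) (barker L₁ (stepVec s i) z.2)) *
        (regNorm blk η j (z.1 + stepVec s i - z.2) - regNorm blk η j (z.1 - z.2)) +
      (barker L₁ (stepVec s i) z.2 -
          min (barker L₀ (stepVec s i) z.1) (barker L₁ (stepVec s i) z.2)) *
        (regNorm blk η j (z.1 - (z.2 + stepVec s i)) - regNorm blk η j (z.1 - z.2))) γ := by
    intro i
    have q0 : Measurable fun z : (P → ℝ) × (P → ℝ) => barker L₀ (stepVec s i) z.1 :=
      (hm₀ i).comp measurable_fst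
    have q1 : Measurable fun z : (P → ℝ) × (P → ℝ) => barker L₁ (stepVec s i) z.2 :=
      (hm₁ i).comp measurable_snd
    refine (bdd (q0.sub (q0.min q1)) (fun z => ?_) ((hi1 i).sub (hR0 j))).add
      (bdd (q1.sub (q0.min q1)) (fun z => ?_) ((hi2 i).sub (hR0 j)))
    · have e0 := hb₀ i z.1
      have e1 := hb₁ i z.2
      have e2 := le_min e0.1 e1.1
      exact ⟨sub_nonneg.2 (min_le_left _ _), by
        change barker L₀ (stepVec s i) z.1 - min _ _ ≤ 1
        linarith [e0.2]⟩
    · have e0 := hb₀ i z.1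
      have e1 := hb₁ i z.2
      have e2 := le_min e0.1 e1.1
      exact ⟨sub_nonneg.2 (min_le_right _ _), by
        change barker L₁ (stepVec s i) z.2 - min _ _ ≤ 1
        linarith [e1.2]⟩
  have hE₀ := h₀.integrable_barkerErr hs hs1 hη
  have hE₁ := h₁.integrable_barkerErr hs hs1 hη
  have hG := integrable_blkNorm_score_sub (blk := blk) h₀ hint j
  have g0 : Integrable (fun z => barkerErr L₀ s η z.1 + barkerErr L₁ s η z.2) γ :=
    (fstI _ hE₀).add (sndI _ hE₁)
  have g1 : Integrable (fun z => barkerErr L₀ s η z.1 + barkerErr L₁ s η z.2 +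
      blkNorm blk j (score L₀ z.1 - score L₁ z.1)) γ :=
    g0.add (fstI _ hG)
  have g2 : Integrable (fun z => -a j * (regNorm blk η j (z.1 - z.2) - η)) γ :=
    ((hR0 j).sub (integrable_const _)).const_mul _
  have g3 : Integrable (fun z => ∑ k, K j k * regNorm blk η k (z.1 - z.2)) γ :=
    integrable_finsetSum _ fun k _ => (hR0 k).const_mul _
  have g12 : Integrable (fun z => barkerErr L₀ s η z.1 + barkerErr L₁ s η z.2 +
      blkNorm blk j (score L₀ z.1 - score L₁ z.1) +
        -a j * (regNorm blk η j (z.1 - z.2) - η)) γ := g1.add g2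
  have hle : ∑ i : P × Bool, ∫ z,
      ((barker L₀ (stepVec s i) z.1 -
          min (barker L₀ (stepVec s i) z.1) (barker L₁ (stepVec s i) z.2)) *
        (regNorm blk η j (z.1 + stepVec s i - z.2) - regNorm blk η j (z.1 - z.2)) +
      (barker L₁ (stepVec s i) z.2 -
          min (barker L₀ (stepVec s i) z.1) (barker L₁ (stepVec s i) z.2)) *
        (regNorm blk η j (z.1 - (z.2 + stepVec s i)) - regNorm blk η j (z.1 - z.2))) ∂γ ≤
      s ^ 2 / 2 * (∫ x, barkerErr L₀ s η x ∂μ + ∫ x, barkerErr L₁ s η x ∂ν + D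
        + -a j * (∫ z, regNorm blk η j (z.1 - z.2) ∂γ - η)
        + ∑ k, K j k * ∫ z, regNorm blk η k (z.1 - z.2) ∂γ) := by
    rw [← integral_finsetSum _ fun i _ => hint2 i]
    have g123 : Integrable (fun z => s ^ 2 / 2 * (barkerErr L₀ s η z.1 + barkerErr L₁ s η z.2 +
        blkNorm blk j (score L₀ z.1 - score L₁ z.1) + -a j * (regNorm blk η j (z.1 - z.2) - η) +
        ∑ k, K j k * regNorm blk η k (z.1 - z.2))) γ := (g12.add g3).const_mul _
    refine (integral_mono (integrable_finsetSum _ fun i _ => hint2 i) g123 fun z => ?_).trans ?_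
    · have hp := sum_move_le blk hs hη j (fun i => barker L₀ (stepVec s i) z.1)
        (fun i => barker L₁ (stepVec s i) z.2) (z.1 - z.2) (score L₀ z.1) (score L₁ z.1)
        (score L₁ z.2)
      have hq := drift_div_le blk hη j (z.1 - z.2) (ha j) (hK j) (hdis z.1 z.2 j)
      have hs2 : 0 ≤ s ^ 2 / 2 := by positivity
      have e1 : ∀ i : P × Bool, z.1 + stepVec s i - z.2 = z.1 - z.2 + stepVec s i :=
        fun i => by abel
      have e2 : ∀ i : P × Bool, z.1 - (z.2 + stepVec s i) = z.1 - z.2 - stepVec s i :=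
        fun i => by abel
      simp only [e1, e2]
      refine hp.trans (mul_le_mul_of_nonneg_left ?_ hs2)
      simp only [barkerErr]
      linarith
    · rw [integral_const_mul, integral_add g12 g3, integral_add g1 g2,
        integral_add g0 (fstI _ hG),
        integral_add (fstI _ hE₀) (sndI _ hE₁), fstE _ hE₀, sndE _ hE₁, fstE _ hG,
        integral_const_mul, integral_sub (hR0 j) (integrable_const _), integral_const,
        integral_finsetSum _ fun k _ => (hR0 k).const_mul _]
      simp only [integral_const_mul, probReal_univ, one_smul]
      have := hD j
      gcongr
  set Rj := ∫ z, regNorm blk η j (z.1 - z.2) ∂γ with hRj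
  set e₀ := ∫ x, barkerErr L₀ s η x ∂μ
  set e₁ := ∫ x, barkerErr L₁ s η x ∂ν
  have hT0 : 0 ≤ T := (integral_nonneg fun z => Real.sqrt_nonneg _).trans (hT j)
  have hKT : ∑ k, K j k * ∫ z, regNorm blk η k (z.1 - z.2) ∂γ ≤ (a j - κ) * T := by
    calc _ ≤ ∑ k, K j k * T := Finset.sum_le_sum fun k _ =>
          mul_le_mul_of_nonneg_left (hT k) (hK j k)
      _ = (∑ k, K j k) * T := by rw [Finset.sum_mul]
      _ ≤ _ := mul_le_mul_of_nonneg_right (by linarith [hsum j]) hT0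
  have hcard : (0 : ℝ) < Fintype.card P := by exact_mod_cast Fintype.card_pos
  set h := s ^ 2 / (4 * Fintype.card P) with hh
  have hh0 : 0 ≤ h := by positivity
  have hcd : (Fintype.card (P × Bool) : ℝ)⁻¹ * (s ^ 2 / 2) = h := by
    rw [hh, Fintype.card_prod, Fintype.card_bool]
    push_cast
    field_simp
    norm_num
  have hinv : (0 : ℝ) ≤ (Fintype.card (P × Bool) : ℝ)⁻¹ := by positivity
  have h3 := mul_le_mul_of_nonneg_left hle hinv
  rw [← mul_assoc, hcd] at h3
  refine (add_le_add_right h3 Rj).trans ?_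
  have hR1 : (1 - h * a j) * Rj ≤ (1 - h * a j) * T :=
    mul_le_mul_of_nonneg_left (hT j)
      (sub_nonneg.2 ((mul_le_mul_of_nonneg_left (hA j) hh0).trans hsA))
  have h4 := mul_le_mul_of_nonneg_left hKT hh0
  have h5 := mul_le_mul_of_nonneg_left (mul_le_mul_of_nonneg_right (hA j) hη.le) hh0
  nlinarith

theorem exists_coupling_integral_blkNorm_le [Nonempty P] [Fintype B] (hμ : μ = gibbs L₀ k₀)
    (hν : ν = gibbs L₁ k₁) (h₀ : TameLogDensity L₀ μ) (h₁ : TameLogDensity L₁ ν)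
    (hint : ∀ p, Integrable (fun x => score L₁ x p) μ)
    (hκ : 0 < κ) (hK : ∀ j k, 0 ≤ K j k) (hsum : ∀ j, ∑ k, K j k + κ ≤ a j)
    (hdis : BlockDissipative blk L₁ a K) {D : ℝ}
    (hD : ∀ j, ∫ x, blkNorm blk j (score L₀ x - score L₁ x) ∂μ ≤ D) {e : ℝ} (he : 0 < e) :
    ∃ γ, IsCoupling γ μ ν ∧ ∀ j, ∫ z, blkNorm blk j (z.1 - z.2) ∂γ ≤ D / κ + e := by
  have ha : ∀ j, 0 < a j := fun j => by
    linarith [hsum j, Finset.sum_nonneg fun k (_ : k ∈ Finset.univ) => hK j k]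
  set A := ∑ j, a j + 1 with hAdef
  have hA : ∀ j, a j ≤ A := fun j => by
    have := Finset.single_le_sum (f := a) (fun k _ => (ha k).le) (Finset.mem_univ j)
    linarith
  have hA0 : 0 < A := by linarith [Finset.sum_nonneg fun k (_ : k ∈ Finset.univ) => (ha k).le]
  set η := κ * e / (3 * A) with hηdef
  have hη : 0 < η := by positivity
  have hcard : (0 : ℝ) < Fintype.card P := by exact_mod_cast Fintype.card_pos
  have hlim := (h₀.tendsto_integral_barkerErr hη).add (h₁.tendsto_integral_barkerErr hη)
  rw [add_zero] at hlim
  have hstep : Filter.Tendsto (fun s : ℝ => s ^ 2 / (4 * Fintype.card P) * A)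
      (nhdsWithin 0 (Set.Ioi 0)) (nhds 0) := by
    have hc : Continuous fun s : ℝ => s ^ 2 / (4 * Fintype.card P) * A := by fun_prop
    simpa using (hc.tendsto 0).mono_left nhdsWithin_le_nhds
  have hI : ∀ᶠ s in nhdsWithin (0 : ℝ) (Set.Ioi 0), s ∈ Set.Ioc (0 : ℝ) 1 :=
    Ioc_mem_nhdsGT zero_lt_one
  obtain ⟨s, hs, hserr, hsA⟩ := (hI.and
    ((hlim.eventually_lt_const (show 0 < κ * e / 3 by positivity)).and
      (hstep.eventually_le_const (show (0 : ℝ) < 1 by norm_num)))).exists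
  set h := s ^ 2 / (4 * Fintype.card P) with hh
  have hh0 : 0 < h := by have := hs.1; positivity
  set q := D + (∫ x, barkerErr L₀ s η x ∂μ + ∫ x, barkerErr L₁ s η x ∂ν) + A * η with hq
  let S : Set ℝ := {T | ∃ γ, IsCoupling γ μ ν ∧ ∀ j, ∫ z, regNorm blk η j (z.1 - z.2) ∂γ ≤ T}
  rcases isEmpty_or_nonempty B with hB | ⟨⟨j₀⟩⟩
  · exact ⟨μ.prod ν, ⟨by simp, by simp⟩, fun j => (hB.false j).elim⟩
  have hS : S.Nonempty := by
    refine ⟨∑ j, ∫ z, regNorm blk η j (z.1 - z.2) ∂(μ.prod ν), μ.prod ν, ⟨by simp, by simp⟩,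
      fun j => ?_⟩
    exact Finset.single_le_sum (f := fun j => ∫ z, regNorm blk η j (z.1 - z.2) ∂(μ.prod ν))
      (fun k _ => integral_nonneg fun z => Real.sqrt_nonneg _) (Finset.mem_univ j)
  have hbdd : BddBelow S := ⟨0, fun T ⟨γ, _, hT⟩ =>
    (integral_nonneg fun z => Real.sqrt_nonneg _).trans (hT j₀)⟩
  obtain ⟨T, ⟨γ, hγ, hT⟩, hTle⟩ := exists_le_of_contraction hS hbdd
    (mul_pos hh0 hκ) (q := q / κ) (e := e / 3) (by positivity) fun T ⟨γ, hγ, hT⟩ => by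
      obtain ⟨γ', hγ', hT'⟩ := exists_coupling_step hμ hν h₀ h₁ hint (fun j => (ha j).le) hK hsum
        hdis hD hs.1 hs.2 hη hA hsA hγ hT
      refine ⟨γ', hγ', fun j => (hT' j).trans (le_of_eq ?_)⟩
      rw [← hq, mul_assoc h κ, mul_sub κ, mul_div_cancel₀ _ hκ.ne']
  refine ⟨γ, hγ, fun j => ?_⟩
  have hq2 : q / κ ≤ D / κ + 2 * e / 3 := by
    rw [div_le_iff₀ hκ, add_mul, div_mul_cancel₀ _ hκ.ne']
    have : A * η = κ * e / 3 := by rw [hηdef]; field_simp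
    linarith
  by_cases hi : Integrable (fun z => regNorm blk η j (z.1 - z.2)) γ
  · refine ((integral_mono_of_nonneg (Filter.Eventually.of_forall fun z => blkNorm_nonneg _ _ _)
      hi (Filter.Eventually.of_forall fun z => blkNorm_le_regNorm blk η j _)).trans (hT j)).trans ?_
    linarith
  · have hprob : IsProbabilityMeasure (γ.map Prod.fst) := by rw [hγ.1]; infer_instance
    have : IsProbabilityMeasure γ := Measure.isProbabilityMeasure_of_map Prod.fst
    refine (hi ?_).elim
    have i1 := h₀.integrable_norm
    have i2 := h₁.integrable_norm
    rw [← hγ.1] at i1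
    rw [← hγ.2] at i2
    simpa using integrable_regNorm_sub blk (i1.comp_measurable measurable_fst)
      (i2.comp_measurable measurable_snd) hη.le j 0 0

end Contraction

lemma abs_sqrt_sub_sqrt_le {ε : ℝ} (hε : 0 ≤ ε) (a b c d : ℝ) :
    |√(a ^ 2 + b ^ 2 + ε) - √(c ^ 2 + d ^ 2 + ε)| ≤ |a - c| + |b - d| := by
  have key : ∀ a b c d : ℝ, √(a ^ 2 + b ^ 2 + ε) ≤ √(c ^ 2 + d ^ 2 + ε) + (|a - c| + |b - d|) := by
    intro a b c d
    set Y := √(c ^ 2 + d ^ 2 + ε) with hY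
    have hY0 : 0 ≤ Y := Real.sqrt_nonneg _
    have hY2 : Y ^ 2 = c ^ 2 + d ^ 2 + ε := Real.sq_sqrt (by positivity)
    have hc : |c| ≤ Y := Real.abs_le_sqrt (by nlinarith [sq_nonneg d])
    have hd : |d| ≤ Y := Real.abs_le_sqrt (by nlinarith [sq_nonneg c])
    refine Real.sqrt_le_iff.2 ⟨by positivity, ?_⟩
    have h1 : a ^ 2 ≤ c ^ 2 + 2 * Y * |a - c| + |a - c| ^ 2 := by
      have e : c * (a - c) ≤ Y * |a - c| := (le_abs_self _).trans (by rw [abs_mul]; gcongr)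
      rw [sq_abs]; nlinarith
    have h2 : b ^ 2 ≤ d ^ 2 + 2 * Y * |b - d| + |b - d| ^ 2 := by
      have e : d * (b - d) ≤ Y * |b - d| := (le_abs_self _).trans (by rw [abs_mul]; gcongr)
      rw [sq_abs]; nlinarith
    nlinarith [mul_nonneg (abs_nonneg (a - c)) (abs_nonneg (b - d))]
  rw [abs_sub_le_iff]
  refine ⟨by linarith [key a b c d], ?_⟩
  have := key c d a b
  rw [abs_sub_comm c a, abs_sub_comm d b] at this
  linarith

lemma normalized_sub_sq_le {ε : ℝ} (hε : 0 < ε) (a b c d : ℝ) :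
    (a / √(a ^ 2 + b ^ 2 + ε) - c / √(c ^ 2 + d ^ 2 + ε)) ^ 2 +
      (b / √(a ^ 2 + b ^ 2 + ε) - d / √(c ^ 2 + d ^ 2 + ε)) ^ 2 ≤
      ((a - c) ^ 2 + (b - d) ^ 2) / ε := by
  set X := √(a ^ 2 + b ^ 2 + ε) with hX
  set Y := √(c ^ 2 + d ^ 2 + ε) with hY
  have hX0 : 0 < X := Real.sqrt_pos.2 (by positivity)
  have hY0 : 0 < Y := Real.sqrt_pos.2 (by positivity)
  have hX2 : X ^ 2 = a ^ 2 + b ^ 2 + ε := Real.sq_sqrt (by positivity)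
  have hY2 : Y ^ 2 = c ^ 2 + d ^ 2 + ε := Real.sq_sqrt (by positivity)
  have hXY : 0 < X * Y := mul_pos hX0 hY0
  have hsXY : a * c + b * d + ε ≤ X * Y := by
    refine le_of_abs_le (abs_le_of_sq_le_sq ?_ hXY.le)
    rw [mul_pow, hX2, hY2]
    nlinarith [sq_nonneg (a * d - b * c), mul_nonneg hε.le (sq_nonneg (a - c)),
      mul_nonneg hε.le (sq_nonneg (b - d))]
  have hεXY : ε ≤ X * Y := by
    refine le_of_abs_le (abs_le_of_sq_le_sq ?_ hXY.le)
    rw [mul_pow, hX2, hY2]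
    have : 0 ≤ (a ^ 2 + b ^ 2) := by positivity
    have : 0 ≤ (c ^ 2 + d ^ 2) := by positivity
    nlinarith [mul_nonneg ‹0 ≤ a ^ 2 + b ^ 2› ‹0 ≤ c ^ 2 + d ^ 2›]
  have e1 : (a / X - c / Y) ^ 2 + (b / X - d / Y) ^ 2 + ε * (1 / X - 1 / Y) ^ 2 =
      2 * (X * Y - (a * c + b * d + ε)) / (X * Y) := by
    have h1 : (a / X - c / Y) ^ 2 + (b / X - d / Y) ^ 2 + ε * (1 / X - 1 / Y) ^ 2 =
      (a ^ 2 + b ^ 2 + ε) / X ^ 2 + (c ^ 2 + d ^ 2 + ε) / Y ^ 2 -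
        2 * (a * c + b * d + ε) / (X * Y) := by
      field_simp
      ring
    rw [h1, ← hX2, ← hY2]
    field_simp
    ring
  have e2 : 2 * (X * Y - (a * c + b * d + ε)) / (X * Y) ≤
      2 * (X * Y - (a * c + b * d + ε)) / ε := by
    gcongr
  have e3 : 2 * (X * Y - (a * c + b * d + ε)) / ε ≤ ((a - c) ^ 2 + (b - d) ^ 2) / ε := by
    gcongr
    nlinarith [sq_nonneg (X - Y)]
  nlinarith [mul_nonneg hε.le (sq_nonneg (1 / X - 1 / Y))]

lemma abs_normalized_sub_le {ε : ℝ} (hε : 0 < ε) (a b c d w₁ w₂ : ℝ) :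
    |(a * w₁ + b * w₂) / √(a ^ 2 + b ^ 2 + ε) - (c * w₁ + d * w₂) / √(c ^ 2 + d ^ 2 + ε)| ≤
      1 / √ε * (√((a - c) ^ 2 + (b - d) ^ 2) * √(w₁ ^ 2 + w₂ ^ 2)) := by
  have h := normalized_sub_sq_le hε a b c d
  rw [← Real.sqrt_mul (by positivity), ← Real.sqrt_one, ← Real.sqrt_div zero_le_one,
    ← Real.sqrt_mul (by positivity)]
  refine Real.abs_le_sqrt ?_
  set X := √(a ^ 2 + b ^ 2 + ε)
  set Y := √(c ^ 2 + d ^ 2 + ε)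
  have e : (a * w₁ + b * w₂) / X - (c * w₁ + d * w₂) / Y =
      (a / X - c / Y) * w₁ + (b / X - d / Y) * w₂ := by ring
  rw [e, ← mul_assoc, div_mul_eq_mul_div, one_mul]
  have h2 := mul_le_mul_of_nonneg_right h (show 0 ≤ w₁ ^ 2 + w₂ ^ 2 by positivity)
  nlinarith [sq_nonneg ((a / X - c / Y) * w₂ - (b / X - d / Y) * w₁)]

lemma sqrt_sub_sq_add_sub_sq_le (a b c : ℝ) :
    √((b - a) ^ 2 + (c - a) ^ 2) ≤ 3 / 2 * |a| + |b| + |c| := by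
  refine Real.sqrt_le_iff.2 ⟨by positivity, ?_⟩
  have h1 : (b - a) ^ 2 ≤ (|b| + |a|) ^ 2 := by
    rw [← sq_abs]; exact pow_le_pow_left₀ (abs_nonneg _) (abs_sub _ _) 2
  have h2 : (c - a) ^ 2 ≤ (|c| + |a|) ^ 2 := by
    rw [← sq_abs]; exact pow_le_pow_left₀ (abs_nonneg _) (abs_sub _ _) 2
  nlinarith [mul_nonneg (abs_nonneg a) (abs_nonneg b), mul_nonneg (abs_nonneg a) (abs_nonneg c),
    mul_nonneg (abs_nonneg b) (abs_nonneg c), sq_nonneg |a|]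

section Shift

variable {P B : Type*} [Fintype P] [DecidableEq B] (blk : P → B)

open Classical in
/-- Zero-one indicator of a proposition. -/
def ind (p : Prop) : ℝ := if p then 1 else 0

lemma ind_nonneg (p : Prop) : 0 ≤ ind p := by unfold ind; split <;> norm_num

lemma sq_ind (p : Prop) : ind p ^ 2 = ind p := by unfold ind; split <;> norm_num

lemma sum_ind_le_one {ι : Type*} [Fintype ι] {R : ι → Prop} (h : ∀ i j, R i → R j → i = j) :
    ∑ i, ind (R i) ≤ 1 := by
  classical
  unfold ind
  rw [← Finset.sum_filter, Finset.sum_const, nsmul_eq_mul, mul_one]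
  exact_mod_cast Finset.card_le_one.2 fun a ha b hb =>
    h a b (Finset.mem_filter.1 ha).2 (Finset.mem_filter.1 hb).2

lemma ind_or_le (p q : Prop) : ind (p ∨ q) ≤ ind p + ind q := by
  unfold ind
  by_cases hp : p <;> by_cases hq : q <;> simp [hp, hq]

/-- A partial injection moving points of block `k` into block `k` or an `R`-neighbour increases
block norms at most by summing over the blocks it can reach. -/
lemma blkNorm_shift_le [Fintype B] {G : P → P → Prop} {R : B → B → Prop}
    (hfun : ∀ p q q', G p q → G p q' → q = q') (hinj : ∀ p p' q, G p q → G p' q → p = p')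
    (hR : ∀ p q, G p q → blk q = blk p ∨ R (blk p) (blk q)) (k : B) (z : P → ℝ) :
    blkNorm blk k (fun p => ∑ q, ind (G p q) * z q) ≤
      ∑ l, ind (l = k ∨ R k l) * blkNorm blk l z := by
  refine Real.sqrt_le_iff.2 ⟨Finset.sum_nonneg fun l _ =>
    mul_nonneg (ind_nonneg _) (blkNorm_nonneg _ _ _), ?_⟩
  have h1 : ∀ p, (∑ q, ind (G p q) * z q) ^ 2 ≤ ∑ q, ind (G p q) * z q ^ 2 := fun p => by
    have hcs := Finset.sum_mul_sq_le_sq_mul_sq Finset.univ (fun q => ind (G p q))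
      (fun q => ind (G p q) * z q)
    have e1 : ∀ q, ind (G p q) * (ind (G p q) * z q) = ind (G p q) * z q := fun q => by
      rw [← mul_assoc, ← sq, sq_ind]
    have e2 : ∀ q, (ind (G p q) * z q) ^ 2 = ind (G p q) * z q ^ 2 := fun q => by
      rw [mul_pow, sq_ind]
    simp only [e1, e2, sq_ind] at hcs
    refine hcs.trans (mul_le_of_le_one_left (Finset.sum_nonneg fun q _ =>
      mul_nonneg (ind_nonneg _) (sq_nonneg _)) (sum_ind_le_one fun i j => hfun p i j))
  calc ∑ p with blk p = k, (∑ q, ind (G p q) * z q) ^ 2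
      ≤ ∑ p with blk p = k, ∑ q, ind (G p q) * z q ^ 2 := Finset.sum_le_sum fun p _ => h1 p
    _ = ∑ q, (∑ p, ind (blk p = k ∧ G p q)) * z q ^ 2 := by
        rw [Finset.sum_filter, Finset.sum_congr rfl fun q _ => Finset.sum_mul _ _ _,
          Finset.sum_comm]
        refine Finset.sum_congr rfl fun p _ => ?_
        split_ifs with hp
        · exact Finset.sum_congr rfl fun q _ => by rw [eq_true hp, true_and]
        · refine (Finset.sum_eq_zero fun q _ => ?_).symm
          rw [show ind (blk p = k ∧ G p q) = 0 from if_neg fun h => hp h.1, zero_mul]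
    _ ≤ ∑ q, ind (blk q = k ∨ R k (blk q)) * z q ^ 2 := by
        refine Finset.sum_le_sum fun q _ => mul_le_mul_of_nonneg_right ?_ (sq_nonneg _)
        by_cases hq : ∃ p, blk p = k ∧ G p q
        · obtain ⟨p, hp, hpq⟩ := hq
          have : ind (blk q = k ∨ R k (blk q)) = 1 := if_pos (hp ▸ hR p q hpq)
          rw [this]
          exact sum_ind_le_one fun i j hi hj => hinj i j q hi.2 hj.2
        · push Not at hq
          rw [Finset.sum_eq_zero fun p _ =>
            show ind (blk p = k ∧ G p q) = 0 from if_neg fun h => hq p h.1 h.2]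
          exact ind_nonneg _
    _ = ∑ l, ind (l = k ∨ R k l) * blkNorm blk l z ^ 2 := by
        rw [← Finset.sum_fiberwise Finset.univ blk]
        refine Finset.sum_congr rfl fun l _ => ?_
        rw [sq_blkNorm, Finset.mul_sum]
        exact Finset.sum_congr rfl fun q hq => by rw [(Finset.mem_filter.1 hq).2]
    _ ≤ _ := by
        have := Finset.sum_sq_le_sq_sum_of_nonneg (s := (Finset.univ : Finset B))
          (f := fun l => ind (l = k ∨ R k l) * blkNorm blk l z) fun l _ =>
            mul_nonneg (ind_nonneg _) (blkNorm_nonneg _ _ _)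
        simpa only [mul_pow, sq_ind] using this

lemma blkNorm_add_le (j : B) (u v : P → ℝ) :
    blkNorm blk j (u + v) ≤ blkNorm blk j u + blkNorm blk j v := by
  refine Real.sqrt_le_iff.2 ⟨add_nonneg (blkNorm_nonneg _ _ _) (blkNorm_nonneg _ _ _), ?_⟩
  rw [add_sq, sq_blkNorm, sq_blkNorm]
  have := sum_mul_le_blkNorm blk j u v
  simp only [Pi.add_apply, add_sq, Finset.sum_add_distrib, mul_assoc, ← Finset.mul_sum]
  linarith

lemma blkNorm_smul {c : ℝ} (hc : 0 ≤ c) (j : B) (u : P → ℝ) :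
    blkNorm blk j (c • u) = c * blkNorm blk j u := by
  unfold blkNorm
  simp only [Pi.smul_apply, smul_eq_mul, mul_pow, ← Finset.mul_sum]
  rw [Real.sqrt_mul (sq_nonneg _), Real.sqrt_sq hc]

lemma blkNorm_abs (j : B) (u : P → ℝ) : blkNorm blk j (fun p => |u p|) = blkNorm blk j u := by
  simp only [blkNorm, sq_abs]

end Shift

/-- `q` is the vertical successor of `p` in an `n × n` grid. -/
def NextV {n : ℕ} (p q : Fin n × Fin n) : Prop := q.1 = p.1 ∧ (q.2 : ℕ) = p.2 + 1

/-- `q` is the horizontal successor of `p` in an `n × n` grid. -/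
def NextH {n : ℕ} (p q : Fin n × Fin n) : Prop := (q.1 : ℕ) = p.1 + 1 ∧ q.2 = p.2

section Next

variable {n : ℕ}

lemma NextV.right_unique (p q q' : Fin n × Fin n) (h : NextV p q) (h' : NextV p q') : q = q' :=
  Prod.ext (h.1.trans h'.1.symm) (Fin.ext (h.2.trans h'.2.symm))

lemma NextV.left_unique (p p' q : Fin n × Fin n) (h : NextV p q) (h' : NextV p' q) : p = p' :=
  Prod.ext (h.1.symm.trans h'.1) (Fin.ext (by have := h.2; have := h'.2; omega))

lemma NextH.right_unique (p q q' : Fin n × Fin n) (h : NextH p q) (h' : NextH p q') : q = q' :=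
  Prod.ext (Fin.ext (h.1.trans h'.1.symm)) (h.2.trans h'.2.symm)

lemma NextH.left_unique (p p' q : Fin n × Fin n) (h : NextH p q) (h' : NextH p' q) : p = p' :=
  Prod.ext (Fin.ext (by have := h.1; have := h'.1; omega)) (h.2.symm.trans h'.2)

lemma succ_div_eq_or (a m : ℕ) : (a + 1) / m = a / m ∨ (a + 1) / m = a / m + 1 := by
  rw [Nat.succ_div]
  split_ifs
  · exact Or.inr rfl
  · exact Or.inl rfl

variable {m : ℕ} (hm : m ∣ n)

lemma NextV.blkOf (p q : Pix n) (h : NextV p q) :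
    blkOf m hm q = blkOf m hm p ∨ NextV (blkOf m hm p) (blkOf m hm q) := by
  have h1 : (_root_.blkOf m hm q).1 = (_root_.blkOf m hm p).1 := Fin.ext (by simp [_root_.blkOf, h.1])
  rcases succ_div_eq_or p.2 m with h2 | h2
  · exact Or.inl (Prod.ext h1 (Fin.ext (by simp [_root_.blkOf, h.2, h2])))
  · exact Or.inr ⟨h1, by simp [_root_.blkOf, h.2, h2]⟩

lemma NextH.blkOf (p q : Pix n) (h : NextH p q) :
    blkOf m hm q = blkOf m hm p ∨ NextH (blkOf m hm p) (blkOf m hm q) := by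
  have h1 : (_root_.blkOf m hm q).2 = (_root_.blkOf m hm p).2 := Fin.ext (by simp [_root_.blkOf, h.2])
  rcases succ_div_eq_or p.1 m with h2 | h2
  · exact Or.inl (Prod.ext (Fin.ext (by simp [_root_.blkOf, h.1, h2])) h1)
  · exact Or.inr ⟨by simp [_root_.blkOf, h.1, h2], h1⟩

lemma Dv_mulVec (z : Img n) (p : Pix n) :
    (Dv n).mulVec z p = ∑ q, ind (NextV p q) * z q - z p := by
  have h : ∀ q, Dv n p q * z q = ind (NextV p q) * z q - if q = p then z q else 0 := fun q => by
    obtain ⟨p1, p2⟩ := p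
    obtain ⟨q1, q2⟩ := q
    simp only [Dv, Dmat, ind, NextV, kroneckerMap_apply, one_apply, of_apply, Prod.mk.injEq]
    by_cases h1 : q1 = p1
    · by_cases h2 : q2 = p2
      · simp [h1, h2]
      · simp [h1, h2]
    · simp [h1, Ne.symm h1]
  simp only [mulVec, dotProduct, h, Finset.sum_sub_distrib]
  simp

lemma Dh_mulVec (z : Img n) (p : Pix n) :
    (Dh n).mulVec z p = ∑ q, ind (NextH p q) * z q - z p := by
  have h : ∀ q, Dh n p q * z q = ind (NextH p q) * z q - if q = p then z q else 0 := fun q => by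
    obtain ⟨p1, p2⟩ := p
    obtain ⟨q1, q2⟩ := q
    simp only [Dh, Dmat, ind, NextH, kroneckerMap_apply, one_apply, of_apply, Prod.mk.injEq]
    by_cases h2 : q2 = p2
    · by_cases h1 : q1 = p1
      · simp [h1, h2]
      · simp [h1, h2]
    · simp [h2, Ne.symm h2]
  simp only [mulVec, dotProduct, h, Finset.sum_sub_distrib]
  simp

/-- A pointwise majorant of the discrete gradient norm that is monotone in `|z|`. -/
def gradMajorant (z : Img n) : Img n :=
  (3 / 2 : ℝ) • (fun p => |z p|) + (fun p => ∑ q, ind (NextV p q) * |z q|) +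
    fun p => ∑ q, ind (NextH p q) * |z q|

lemma gradMajorant_nonneg (z : Img n) (p : Pix n) : 0 ≤ gradMajorant z p :=
  add_nonneg (add_nonneg (mul_nonneg (by norm_num) (abs_nonneg _))
    (Finset.sum_nonneg fun _ _ => mul_nonneg (ind_nonneg _) (abs_nonneg _)))
    (Finset.sum_nonneg fun _ _ => mul_nonneg (ind_nonneg _) (abs_nonneg _))

lemma abs_sum_ind_mul_le {P : Type*} [Fintype P] (G : P → Prop) (z : P → ℝ) :
    |∑ q, ind (G q) * z q| ≤ ∑ q, ind (G q) * |z q| :=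
  (Finset.abs_sum_le_sum_abs _ _).trans (Finset.sum_le_sum fun q _ => by
    rw [abs_mul, abs_of_nonneg (ind_nonneg _)])

lemma sqrt_sq_Dv_add_sq_Dh_le (z : Img n) (p : Pix n) :
    √((Dv n).mulVec z p ^ 2 + (Dh n).mulVec z p ^ 2) ≤ gradMajorant z p := by
  rw [Dv_mulVec, Dh_mulVec]
  refine (sqrt_sub_sq_add_sub_sq_le _ _ _).trans ?_
  simp only [gradMajorant, Pi.add_apply, Pi.smul_apply, smul_eq_mul]
  gcongr <;> exact abs_sum_ind_mul_le _ _

/-- Which blocks are seen from block `k` by the discrete gradient, with weights. -/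
def stencil {b : ℕ} (k l : Fin b × Fin b) : ℝ :=
  3 / 2 * ind (l = k) + ind (l = k ∨ NextV k l) + ind (l = k ∨ NextH k l)

lemma stencil_nonneg {b : ℕ} (k l : Fin b × Fin b) : 0 ≤ stencil k l := by
  have h1 := ind_nonneg (l = k)
  have h2 := ind_nonneg (l = k ∨ NextV k l)
  have h3 := ind_nonneg (l = k ∨ NextH k l)
  unfold stencil
  linarith

lemma stencil_le {b : ℕ} (k l : Fin b × Fin b) :
    stencil k l ≤ 7 / 2 * ind (l = k) + ind (NextV k l) + ind (NextH k l) := by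
  have h2 := ind_or_le (l = k) (NextV k l)
  have h3 := ind_or_le (l = k) (NextH k l)
  unfold stencil
  linarith

lemma sum_stencil_right_le {b : ℕ} (k : Fin b × Fin b) : ∑ l, stencil k l ≤ 11 / 2 := by
  refine (Finset.sum_le_sum fun l _ => stencil_le k l).trans ?_
  have h1 := sum_ind_le_one (R := fun l => l = k) fun i j hi hj => hi.trans hj.symm
  have h2 := sum_ind_le_one (R := fun l => NextV k l) (NextV.right_unique k)
  have h3 := sum_ind_le_one (R := fun l => NextH k l) (NextH.right_unique k)
  rw [Finset.sum_add_distrib, Finset.sum_add_distrib, ← Finset.mul_sum]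
  linarith

lemma sum_stencil_left_le {b : ℕ} (l : Fin b × Fin b) : ∑ k, stencil k l ≤ 11 / 2 := by
  refine (Finset.sum_le_sum fun k _ => stencil_le k l).trans ?_
  have h1 := sum_ind_le_one (R := fun k => l = k) fun i j hi hj => hi.symm.trans hj
  have h2 := sum_ind_le_one (R := fun k => NextV k l) fun i j => NextV.left_unique i j l
  have h3 := sum_ind_le_one (R := fun k => NextH k l) fun i j => NextH.left_unique i j l
  rw [Finset.sum_add_distrib, Finset.sum_add_distrib, ← Finset.mul_sum]
  linarith

lemma blkNorm_gradMajorant_le (k : Blk n m) (z : Img n) :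
    blkNorm (blkOf m hm) k (gradMajorant z) ≤
      ∑ l, stencil k l * blkNorm (blkOf m hm) l z := by
  have hv := blkNorm_shift_le (blkOf m hm) NextV.right_unique NextV.left_unique
    (NextV.blkOf hm) k (fun q => |z q|)
  have hh := blkNorm_shift_le (blkOf m hm) NextH.right_unique NextH.left_unique
    (NextH.blkOf hm) k (fun q => |z q|)
  simp only [blkNorm_abs] at hv hh
  have hid : blkNorm (blkOf m hm) k ((3 / 2 : ℝ) • fun p => |z p|) =
      ∑ l, 3 / 2 * ind (l = k) * blkNorm (blkOf m hm) l z := by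
    rw [blkNorm_smul _ (by norm_num), blkNorm_abs]
    simp [ind]
  simp only [stencil, add_mul, Finset.sum_add_distrib]
  rw [← hid]
  refine (blkNorm_add_le _ _ _ _).trans (add_le_add ((blkNorm_add_le _ _ _ _).trans ?_) hh)
  exact add_le_add le_rfl hv

/-- Restriction of an image to block `j`, extended by zero. -/
def blkPart (j : Blk n m) (z : Img n) : Img n := fun p => if blkOf m hm p = j then z p else 0

lemma blkNorm_blkPart (j l : Blk n m) (z : Img n) :
    blkNorm (blkOf m hm) l (blkPart hm j z) = if l = j then blkNorm (blkOf m hm) j z else 0 := by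
  unfold blkNorm blkPart
  split_ifs with h
  · subst h
    refine congrArg _ (Finset.sum_congr rfl fun p hp => ?_)
    rw [if_pos (Finset.mem_filter.1 hp).2]
  · rw [Finset.sum_eq_zero, Real.sqrt_zero]
    intro p hp
    rw [if_neg (fun hj => h ((Finset.mem_filter.1 hp).2.symm.trans hj)), sq, zero_mul]

lemma sum_gradMajorant_mul_le (j : Blk n m) (z : Img n) :
    ∑ p, gradMajorant z p * gradMajorant (blkPart hm j z) p ≤
      blkNorm (blkOf m hm) j z *
        ∑ l, (∑ k, stencil k j * stencil k l) * blkNorm (blkOf m hm) l z := by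
  have h2 : ∀ k, blkNorm (blkOf m hm) k (gradMajorant (blkPart hm j z)) ≤
      stencil k j * blkNorm (blkOf m hm) j z := fun k =>
    (blkNorm_gradMajorant_le hm k _).trans (le_of_eq (by simp [blkNorm_blkPart]))
  rw [← Finset.sum_fiberwise Finset.univ (blkOf m hm)]
  calc _ ≤ ∑ k, blkNorm (blkOf m hm) k (gradMajorant z) *
        blkNorm (blkOf m hm) k (gradMajorant (blkPart hm j z)) :=
        Finset.sum_le_sum fun k _ => sum_mul_le_blkNorm _ _ _ _
    _ ≤ ∑ k, (∑ l, stencil k l * blkNorm (blkOf m hm) l z) *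
          (stencil k j * blkNorm (blkOf m hm) j z) :=
        Finset.sum_le_sum fun k _ => mul_le_mul (blkNorm_gradMajorant_le hm k z) (h2 k)
          (blkNorm_nonneg _ _ _) (Finset.sum_nonneg fun l _ =>
            mul_nonneg (stencil_nonneg _ _) (blkNorm_nonneg _ _ _))
    _ = _ := by
        simp only [Finset.sum_mul, Finset.mul_sum]
        rw [Finset.sum_comm]
        refine Finset.sum_congr rfl fun l _ => Finset.sum_congr rfl fun k _ => by ring

lemma sum_stencil_mul_stencil_le {b : ℕ} (j : Fin b × Fin b) :
    ∑ l, ∑ k, stencil k j * stencil k l ≤ 32 := by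
  rw [Finset.sum_comm]
  calc _ = ∑ k, stencil k j * ∑ l, stencil k l := by simp only [Finset.mul_sum]
    _ ≤ ∑ k, stencil k j * (11 / 2) := Finset.sum_le_sum fun k _ =>
        mul_le_mul_of_nonneg_left (sum_stencil_right_le k) (stencil_nonneg _ _)
    _ = (∑ k, stencil k j) * (11 / 2) := by rw [Finset.sum_mul]
    _ ≤ 11 / 2 * (11 / 2) := mul_le_mul_of_nonneg_right (sum_stencil_left_le j) (by norm_num)
    _ ≤ 32 := by norm_num

end Next

/-- The unnormalized log-posterior. -/
def logDens (n : ℕ) (A : Matrix (Pix n) (Pix n) ℝ) (y : Img n) (lam del ε : ℝ) (x : Img n) : ℝ :=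
  -(lam / 2) * ∑ β : Pix n, (y β - A.mulVec x β) ^ 2 - del * tv n ε x

section Score

variable {n : ℕ} (A : Matrix (Pix n) (Pix n) ℝ) (y : Img n) (lam del : ℝ)

lemma differentiable_mulVec_apply (p : Pix n) : Differentiable ℝ fun x => A.mulVec x p := by
  simp only [mulVec, dotProduct]
  fun_prop

lemma differentiable_sum_sq_sub_mulVec :
    Differentiable ℝ fun x => ∑ β : Pix n, (y β - A.mulVec x β) ^ 2 := by
  have := differentiable_mulVec_apply A
  fun_prop

lemma differentiable_tv {ε : ℝ} (hε : 0 < ε) : Differentiable ℝ (tv n ε) := by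
  have h1 := differentiable_mulVec_apply (Dv n)
  have h2 := differentiable_mulVec_apply (Dh n)
  unfold tv
  refine Differentiable.fun_sum fun p _ => Differentiable.sqrt (by fun_prop) fun x => ?_
  positivity

lemma differentiable_logDens {ε : ℝ} (hε : 0 < ε) :
    Differentiable ℝ (logDens n A y lam del ε) :=
  ((differentiable_sum_sq_sub_mulVec A y).const_mul _).sub ((differentiable_tv hε).const_mul _)

lemma hasLineDerivAt_logDens {ε : ℝ} (hε : 0 < ε) (x w : Img n) :
    HasLineDerivAt ℝ (logDens n A y lam del ε)
      (lam * ∑ β, (y β - A.mulVec x β) * A.mulVec w β -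
        del * ∑ p, ((Dv n).mulVec x p * (Dv n).mulVec w p + (Dh n).mulVec x p * (Dh n).mulVec w p) /
          √((Dv n).mulVec x p ^ 2 + (Dh n).mulVec x p ^ 2 + ε)) x w := by
  have lin : ∀ (M : Matrix (Pix n) (Pix n) ℝ) p, HasDerivAt (fun t : ℝ => M.mulVec (x + t • w) p)
      (M.mulVec w p) 0 := fun M p => by
    simp only [mulVec_add, mulVec_smul, Pi.add_apply, Pi.smul_apply, smul_eq_mul]
    simpa using ((hasDerivAt_id (0 : ℝ)).mul_const (M.mulVec w p)).const_add (M.mulVec x p)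
  unfold HasLineDerivAt logDens tv
  have h1 := HasDerivAt.fun_sum fun β (_ : β ∈ Finset.univ) => ((lin A β).const_sub (y β)).fun_pow 2
  have h2 := HasDerivAt.fun_sum fun p (_ : p ∈ Finset.univ) =>
    ((((lin (Dv n) p).fun_pow 2).fun_add ((lin (Dh n) p).fun_pow 2)).add_const ε).sqrt (by positivity)
  refine ((h1.const_mul (-(lam / 2))).sub (h2.const_mul del)).congr_deriv ?_
  simp only [zero_smul, add_zero, Finset.mul_sum]
  congr 1
  · refine Finset.sum_congr rfl fun β _ => ?_
    push_cast
    ring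
  · refine Finset.sum_congr rfl fun p _ => ?_
    have : √((Dv n).mulVec x p ^ 2 + (Dh n).mulVec x p ^ 2 + ε) ≠ 0 :=
      (Real.sqrt_pos.2 (by positivity)).ne'
    field_simp
    push_cast
    ring

lemma sum_mul_score {P : Type*} [Fintype P] [DecidableEq P] (L : (P → ℝ) → ℝ) (x w : P → ℝ) :
    ∑ p, w p * score L x p = fderiv ℝ L x w := by
  rw [← ContinuousLinearMap.coe_coe, LinearMap.pi_apply_eq_sum_univ]
  refine Finset.sum_congr rfl fun p _ => ?_
  rw [smul_eq_mul, score, ContinuousLinearMap.coe_coe,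
    show (Pi.single p 1 : P → ℝ) = fun q => if p = q then 1 else 0 from
      funext fun q => by simp only [Pi.single_apply, eq_comm]]

lemma sum_mul_score_logDens_sub {ε : ℝ} (hε : 0 < ε) (x x' w : Img n) :
    ∑ p, w p * (score (logDens n A y lam del ε) x p - score (logDens n A y lam del ε) x' p) =
      -lam * (w ⬝ᵥ (Aᵀ * A).mulVec (x - x')) - del * ∑ p,
        (((Dv n).mulVec x p * (Dv n).mulVec w p + (Dh n).mulVec x p * (Dh n).mulVec w p) /
          √((Dv n).mulVec x p ^ 2 + (Dh n).mulVec x p ^ 2 + ε) -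
        ((Dv n).mulVec x' p * (Dv n).mulVec w p + (Dh n).mulVec x' p * (Dh n).mulVec w p) /
          √((Dv n).mulVec x' p ^ 2 + (Dh n).mulVec x' p ^ 2 + ε)) := by
  have h : ∀ x, fderiv ℝ (logDens n A y lam del ε) x w = _ := fun x =>
    ((differentiable_logDens A y lam del hε x).hasFDerivAt.hasLineDerivAt w).unique
      (hasLineDerivAt_logDens A y lam del hε x w)
  simp only [mul_sub, Finset.sum_sub_distrib, sum_mul_score, h]
  have e : w ⬝ᵥ (Aᵀ * A).mulVec (x - x') =
      ∑ β, (A.mulVec x β - A.mulVec x' β) * A.mulVec w β := by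
    rw [← mulVec_mulVec, dotProduct_mulVec, vecMul_transpose, dotProduct_comm, mulVec_sub]
    rfl
  rw [e]
  simp only [sub_mul, Finset.sum_sub_distrib]
  ring

end Score

section Dissipative

variable {n m : ℕ} (hm : m ∣ n)

lemma abs_tv_term_le {ε : ℝ} (hε : 0 < ε) (j : Blk n m) (x x' : Img n) :
    |∑ p, (((Dv n).mulVec x p * (Dv n).mulVec (blkPart hm j (x - x')) p +
          (Dh n).mulVec x p * (Dh n).mulVec (blkPart hm j (x - x')) p) /
          √((Dv n).mulVec x p ^ 2 + (Dh n).mulVec x p ^ 2 + ε) -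
        ((Dv n).mulVec x' p * (Dv n).mulVec (blkPart hm j (x - x')) p +
          (Dh n).mulVec x' p * (Dh n).mulVec (blkPart hm j (x - x')) p) /
          √((Dv n).mulVec x' p ^ 2 + (Dh n).mulVec x' p ^ 2 + ε))| ≤
      1 / √ε * (blkNorm (blkOf m hm) j (x - x') *
        ∑ l, (∑ k, stencil k j * stencil k l) * blkNorm (blkOf m hm) l (x - x')) := by
  refine (Finset.abs_sum_le_sum_abs _ _).trans ?_
  refine (Finset.sum_le_sum fun p _ => (abs_normalized_sub_le hε _ _ _ _ _ _).trans
    (mul_le_mul_of_nonneg_left (mul_le_mul ?_ (sqrt_sq_Dv_add_sq_Dh_le _ p) (Real.sqrt_nonneg _)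
      (gradMajorant_nonneg (x - x') p)) (by positivity))).trans ?_
  · rw [← Pi.sub_apply, ← Pi.sub_apply ((Dh n).mulVec x), ← mulVec_sub, ← mulVec_sub]
    exact sqrt_sq_Dv_add_sq_Dh_le _ p
  · rw [← Finset.mul_sum]
    exact mul_le_mul_of_nonneg_left (sum_gradMajorant_mul_le hm j _) (by positivity)

lemma l2_blkRestrict (i : Blk n m) (z : Img n) :
    l2 (blkRestrict m hm i z) = blkNorm (blkOf m hm) i z := by
  unfold l2 blkNorm blkRestrict
  rw [Finset.sum_subtype (p := fun p => blkOf m hm p = i) _ (by simp) (fun p => z p ^ 2)]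

lemma norm_toLp_eq_l2 {ι : Type*} [Fintype ι] (f : ι → ℝ) :
    ‖(WithLp.toLp 2 f : EuclideanSpace ℝ ι)‖ = l2 f := by
  rw [EuclideanSpace.norm_eq]
  simp [l2]

lemma abs_dotProduct_mulVec_le {ι κ : Type*} [Fintype ι] [Fintype κ] [DecidableEq ι] [DecidableEq κ]
    (M : Matrix ι κ ℝ) (u : ι → ℝ) (v : κ → ℝ) : |u ⬝ᵥ M.mulVec v| ≤ opNorm M * (l2 u * l2 v) := by
  have h1 := abs_real_inner_le_norm (WithLp.toLp 2 u : EuclideanSpace ℝ ι)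
    (WithLp.toLp 2 (M.mulVec v))
  have h2 := (LinearMap.toContinuousLinearMap (Matrix.toEuclideanLin M)).le_opNorm
    (WithLp.toLp 2 v)
  rw [LinearMap.coe_toContinuousLinearMap', toLpLin_apply, norm_toLp_eq_l2, norm_toLp_eq_l2] at h2
  rw [EuclideanSpace.inner_eq_star_dotProduct, norm_toLp_eq_l2, norm_toLp_eq_l2, star_trivial,
    dotProduct_comm] at h1
  refine h1.trans ((mul_le_mul_of_nonneg_left h2 (Real.sqrt_nonneg _)).trans (le_of_eq ?_))
  exact mul_left_comm _ _ _

lemma dotProduct_blkPart_mulVec (C : Matrix (Pix n) (Pix n) ℝ) (j : Blk n m) (z : Img n) :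
    blkPart hm j z ⬝ᵥ C.mulVec z =
      ∑ k, blkRestrict m hm j z ⬝ᵥ (subBlk m hm C j k).mulVec (blkRestrict m hm k z) := by
  have h1 : blkPart hm j z ⬝ᵥ C.mulVec z =
      ∑ p : BlkPix m hm j, z p.1 * ∑ k, ∑ q : BlkPix m hm k, C p.1 q.1 * z q.1 := by
    have : ∀ p, C.mulVec z p = ∑ k, ∑ q : BlkPix m hm k, C p q.1 * z q.1 := fun p => by
      simp only [mulVec, dotProduct]
      rw [← Finset.sum_fiberwise Finset.univ (blkOf m hm)]
      exact Finset.sum_congr rfl fun k _ => Finset.sum_subtype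
        (p := fun q => blkOf m hm q = k) _ (by simp) (fun q => C p q * z q)
    simp only [dotProduct, this, blkPart, ite_mul, zero_mul]
    rw [← Finset.sum_filter]
    exact Finset.sum_subtype (p := fun p => blkOf m hm p = j) _ (by simp) _
  rw [h1]
  simp only [Finset.mul_sum]
  rw [Finset.sum_comm]
  simp only [dotProduct, mulVec, blkRestrict, subBlk, of_apply, Finset.mul_sum]

lemma le_dotProduct_blkPart_mulVec {C : Matrix (Pix n) (Pix n) ℝ} {M : Matrix (Blk n m) (Blk n m) ℝ}
    (hdiag : ∀ i, (subBlk m hm C i i -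
      M i i • (1 : Matrix (BlkPix m hm i) (BlkPix m hm i) ℝ)).PosSemidef)
    (hoff : ∀ i j, i ≠ j → opNorm (subBlk m hm C i j) ≤ M i j) (j : Blk n m) (z : Img n) :
    blkNorm (blkOf m hm) j z * (M j j * blkNorm (blkOf m hm) j z -
        ∑ k ∈ Finset.univ.erase j, M j k * blkNorm (blkOf m hm) k z) ≤
      blkPart hm j z ⬝ᵥ C.mulVec z := by
  rw [dotProduct_blkPart_mulVec, ← Finset.add_sum_erase _ _ (Finset.mem_univ j)]
  have h1 : M j j * blkNorm (blkOf m hm) j z ^ 2 ≤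
      blkRestrict m hm j z ⬝ᵥ (subBlk m hm C j j).mulVec (blkRestrict m hm j z) := by
    have := (hdiag j).dotProduct_mulVec_nonneg (blkRestrict m hm j z)
    rw [sub_mulVec, smul_mulVec, one_mulVec, dotProduct_sub, dotProduct_smul] at this
    rw [← l2_blkRestrict, l2, Real.sq_sqrt (Finset.sum_nonneg fun _ _ => sq_nonneg _)]
    simp only [star_trivial, smul_eq_mul, dotProduct, ← sq] at this ⊢
    linarith
  have h2 : ∑ k ∈ Finset.univ.erase j, -(M j k * (blkNorm (blkOf m hm) j z *
      blkNorm (blkOf m hm) k z)) ≤ ∑ k ∈ Finset.univ.erase j,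
        blkRestrict m hm j z ⬝ᵥ (subBlk m hm C j k).mulVec (blkRestrict m hm k z) := by
    refine Finset.sum_le_sum fun k hk => ?_
    have h := abs_dotProduct_mulVec_le (subBlk m hm C j k) (blkRestrict m hm j z)
      (blkRestrict m hm k z)
    rw [l2_blkRestrict, l2_blkRestrict] at h
    have h' := mul_le_mul_of_nonneg_right (hoff j k (Finset.ne_of_mem_erase hk).symm)
      (mul_nonneg (blkNorm_nonneg (blkOf m hm) j z) (blkNorm_nonneg (blkOf m hm) k z))
    linarith [neg_abs_le (blkRestrict m hm j z ⬝ᵥ (subBlk m hm C j k).mulVec (blkRestrict m hm k z))]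
  refine le_trans (le_of_eq ?_) (add_le_add h1 h2)
  rw [mul_sub, Finset.mul_sum, Finset.sum_neg_distrib, ← sub_eq_add_neg]
  congr 1
  · ring
  · exact Finset.sum_congr rfl fun k _ => by ring

/-- Interaction matrix of the score: off-diagonal blocks of `M` plus the total variation part. -/
def interaction (M : Matrix (Blk n m) (Blk n m) ℝ) (lam τ : ℝ) (j k : Blk n m) : ℝ :=
  (if k = j then 0 else lam * M j k) + τ * ∑ l, stencil l j * stencil l k

lemma blockDissipative_logDens {A : Matrix (Pix n) (Pix n) ℝ} {M : Matrix (Blk n m) (Blk n m) ℝ}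
    (hdiag : ∀ i, (subBlk m hm (Aᵀ * A) i i -
      M i i • (1 : Matrix (BlkPix m hm i) (BlkPix m hm i) ℝ)).PosSemidef)
    (hoff : ∀ i j, i ≠ j → opNorm (subBlk m hm (Aᵀ * A) i j) ≤ M i j) (y : Img n)
    {lam del ε : ℝ} (hlam : 0 ≤ lam) (hdel : 0 ≤ del) (hε : 0 < ε) :
    BlockDissipative (blkOf m hm) (logDens n A y lam del ε) (fun j => lam * M j j)
      (interaction M lam (del / √ε)) := by
  intro x x' j
  have h1 := le_dotProduct_blkPart_mulVec hm hdiag hoff j (x - x')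
  have h2 := abs_tv_term_le hm hε j x x'
  have h3 : ∑ p with blkOf m hm p = j, (x - x') p *
      (score (logDens n A y lam del ε) x p - score (logDens n A y lam del ε) x' p) =
      ∑ p, blkPart hm j (x - x') p *
        (score (logDens n A y lam del ε) x p - score (logDens n A y lam del ε) x' p) := by
    rw [Finset.sum_filter]
    refine Finset.sum_congr rfl fun p _ => ?_
    unfold blkPart
    split_ifs <;> simp
  rw [h3, sum_mul_score_logDens_sub A y lam del hε]
  have h4 : ∑ k, interaction M lam (del / √ε) j k * blkNorm (blkOf m hm) k (x - x') =
      lam * ∑ k ∈ Finset.univ.erase j, M j k * blkNorm (blkOf m hm) k (x - x') +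
      del / √ε * ∑ l, (∑ k, stencil k j * stencil k l) * blkNorm (blkOf m hm) l (x - x') := by
    unfold interaction
    simp only [add_mul, Finset.sum_add_distrib, mul_assoc, ← Finset.mul_sum]
    congr 1
    rw [← Finset.add_sum_erase _ _ (Finset.mem_univ j), if_pos rfl, zero_mul, zero_add,
      Finset.mul_sum]
    exact Finset.sum_congr rfl fun k hk => by rw [if_neg (Finset.ne_of_mem_erase hk), mul_assoc]
  rw [h4]
  set T := ∑ l, (∑ k, stencil k j * stencil k l) * blkNorm (blkOf m hm) l (x - x')
  set N := blkNorm (blkOf m hm) j (x - x')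
  have h5 := mul_le_mul_of_nonneg_left ((neg_abs_le _).trans' (neg_le_neg h2)) hdel
  have h6 := mul_le_mul_of_nonneg_left h1 hlam
  have e : del * -(1 / √ε * (N * T)) = -(N * (del / √ε * T)) := by ring
  rw [e] at h5
  nlinarith

lemma interaction_nonneg {A : Matrix (Pix n) (Pix n) ℝ} {M : Matrix (Blk n m) (Blk n m) ℝ}
    (hoff : ∀ i j, i ≠ j → opNorm (subBlk m hm A i j) ≤ M i j) {lam τ : ℝ} (hlam : 0 ≤ lam)
    (hτ : 0 ≤ τ) (j k : Blk n m) : 0 ≤ interaction M lam τ j k := by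
  refine add_nonneg ?_ (mul_nonneg hτ (Finset.sum_nonneg fun l _ =>
    mul_nonneg (stencil_nonneg _ _) (stencil_nonneg _ _)))
  split_ifs with h
  · exact le_rfl
  · exact mul_nonneg hlam ((norm_nonneg _).trans (hoff j k (Ne.symm h)))

lemma sum_interaction_add_le {M : Matrix (Blk n m) (Blk n m) ℝ} {c lam τ : ℝ} (hlam : 0 ≤ lam)
    (hM : ∀ i, (∑ j ∈ Finset.univ.erase i, M i j) + c ≤ M i i) (hτ : 0 ≤ τ)
    (h : 32 * τ ≤ lam * c / 2) (j : Blk n m) :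
    ∑ k, interaction M lam τ j k + lam * c / 2 ≤ lam * M j j := by
  unfold interaction
  rw [Finset.sum_add_distrib, ← Finset.mul_sum, ← Finset.add_sum_erase _ _ (Finset.mem_univ j),
    if_pos rfl, zero_add, Finset.sum_congr rfl fun k hk => if_neg (Finset.ne_of_mem_erase hk),
    ← Finset.mul_sum]
  have h1 := mul_le_mul_of_nonneg_left (hM j) hlam
  have h2 := mul_le_mul_of_nonneg_left (sum_stencil_mul_stencil_le j) hτ
  linarith

end Dissipative

lemma exists_norm_mulVec_le {ι κ : Type*} [Fintype ι] [Fintype κ] (M : Matrix ι κ ℝ) :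
    ∃ C : ℝ, 0 ≤ C ∧ ∀ z p, |M.mulVec z p| ≤ C * ‖z‖ := by
  refine ⟨‖LinearMap.toContinuousLinearMap M.mulVecLin‖, norm_nonneg _, fun z p => ?_⟩
  exact (norm_le_pi_norm (M.mulVec z) p).trans
    ((LinearMap.toContinuousLinearMap M.mulVecLin).le_opNorm z)

lemma abs_tv_sub_le (n : ℕ) {ε : ℝ} (hε : 0 ≤ ε) :
    ∃ C : ℝ, 0 ≤ C ∧ ∀ x x', |tv n ε x - tv n ε x'| ≤ C * ‖x - x'‖ := by
  obtain ⟨Cv, hv0, hv⟩ := exists_norm_mulVec_le (Dv n)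
  obtain ⟨Ch, hh0, hh⟩ := exists_norm_mulVec_le (Dh n)
  refine ⟨∑ _p : Pix n, (Cv + Ch), Finset.sum_nonneg fun _ _ => by positivity, fun x x' => ?_⟩
  unfold tv
  rw [← Finset.sum_sub_distrib, Finset.sum_mul]
  refine (Finset.abs_sum_le_sum_abs _ _).trans (Finset.sum_le_sum fun p _ => ?_)
  refine (abs_sqrt_sub_sqrt_le hε _ _ _ _).trans ?_
  have h1 := hv (x - x') p
  have h2 := hh (x - x') p
  rw [mulVec_sub, Pi.sub_apply] at h1 h2
  linarith

lemma tv_nonneg (n : ℕ) (ε : ℝ) (x : Img n) : 0 ≤ tv n ε x :=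
  Finset.sum_nonneg fun _ _ => Real.sqrt_nonneg _

section Tail

variable {n : ℕ} {A : Matrix (Pix n) (Pix n) ℝ} (y : Img n) {lam del ε : ℝ}

lemma ae_differentiableAt_logDens (hε : 0 ≤ ε) :
    ∀ᵐ x, DifferentiableAt ℝ (logDens n A y lam del ε) x := by
  obtain ⟨C, hC0, hC⟩ := abs_tv_sub_le n hε
  have hL : LipschitzWith ⟨C, hC0⟩ (tv n ε) := LipschitzWith.of_dist_le_mul fun x x' => by
    rw [Real.dist_eq, dist_eq_norm]
    exact hC x x'
  filter_upwards [hL.ae_differentiableAt (μ := volume)] with x hx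
  exact ((differentiable_sum_sq_sub_mulVec A y x).const_mul _).sub (hx.const_mul _)

lemma continuous_logDens (ε : ℝ) : Continuous (logDens n A y lam del ε) := by
  have h := fun (M : Matrix (Pix n) (Pix n) ℝ) p => (differentiable_mulVec_apply M p).continuous
  have h1 := h A
  have h2 := h (Dv n)
  have h3 := h (Dh n)
  unfold logDens tv
  fun_prop

lemma exists_growth_logDens (hε : 0 ≤ ε) :
    ∃ C : ℝ, ∀ (x : Img n) (p : Pix n) (s : ℝ), 0 < s → s ≤ 1 →
      |logDens n A y lam del ε (x + Pi.single p s) -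
        logDens n A y lam del ε (x + Pi.single p (-s))| ≤ s * (C * (1 + ‖x‖)) := by
  obtain ⟨C, hC0, hC⟩ := abs_tv_sub_le n hε
  obtain ⟨K, hK0, hK⟩ := exists_norm_mulVec_le A
  refine ⟨|lam / 2| * ∑ _p : Pix n, 4 * ((‖y‖ + K) * K) + |del| * (C * 2),
    fun x p s hs _ => ?_⟩
  have hx0 := norm_nonneg x
  have e1 : (Pi.single p s : Img n) = s • Pi.single p 1 := by
    ext q
    simp [Pi.single_apply]
  have e2 : (Pi.single p (-s) : Img n) = -(s • Pi.single p 1) := by rw [← e1, Pi.single_neg]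
  have hn : ‖(Pi.single p (1 : ℝ) : Img n)‖ = 1 := by rw [Pi.norm_single, norm_one]
  rw [e1, e2]
  set v : Img n := Pi.single p 1
  have hq : |∑ β, (y β - A.mulVec (x + s • v) β) ^ 2 - ∑ β, (y β - A.mulVec (x + -(s • v)) β) ^ 2| ≤
      s * ((∑ _p : Pix n, 4 * ((‖y‖ + K) * K)) * (1 + ‖x‖)) := by
    rw [← Finset.sum_sub_distrib, Finset.sum_mul, Finset.mul_sum]
    refine (Finset.abs_sum_le_sum_abs _ _).trans (Finset.sum_le_sum fun β _ => ?_)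
    have e : (y β - A.mulVec (x + s • v) β) ^ 2 - (y β - A.mulVec (x + -(s • v)) β) ^ 2 =
        -(4 * s) * ((y β - A.mulVec x β) * A.mulVec v β) := by
      simp only [mulVec_add, mulVec_neg, mulVec_smul, Pi.add_apply, Pi.neg_apply, Pi.smul_apply,
        smul_eq_mul]
      ring
    rw [e, abs_mul, abs_mul, abs_neg, abs_of_pos (by positivity : 0 < 4 * s)]
    have h1 : |y β - A.mulVec x β| ≤ (‖y‖ + K) * (1 + ‖x‖) := by
      have a1 := abs_sub (y β) (A.mulVec x β)
      have a2 := norm_le_pi_norm y β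
      rw [Real.norm_eq_abs] at a2
      have a3 := hK x β
      nlinarith [mul_nonneg (norm_nonneg y) hx0]
    have h2 : |A.mulVec v β| ≤ K := by simpa [hn] using hK v β
    calc 4 * s * (|y β - A.mulVec x β| * |A.mulVec v β|) ≤
        4 * s * ((‖y‖ + K) * (1 + ‖x‖) * K) := by gcongr
      _ = _ := by ring
  have ht : |tv n ε (x + s • v) - tv n ε (x + -(s • v))| ≤ s * (C * 2) := by
    refine (hC _ _).trans (le_of_eq ?_)
    rw [show x + s • v - (x + -(s • v)) = (2 * s) • v by rw [two_mul, add_smul]; abel, norm_smul,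
      hn, Real.norm_of_nonneg (by positivity)]
    ring
  have e : logDens n A y lam del ε (x + s • v) - logDens n A y lam del ε (x + -(s • v)) =
      -(lam / 2) * (∑ β, (y β - A.mulVec (x + s • v) β) ^ 2 -
        ∑ β, (y β - A.mulVec (x + -(s • v)) β) ^ 2) -
      del * (tv n ε (x + s • v) - tv n ε (x + -(s • v))) := by
    unfold logDens
    ring
  rw [e]
  refine (abs_sub _ _).trans ?_
  rw [abs_mul, abs_mul, abs_neg]
  have h1 := mul_le_mul_of_nonneg_left hq (abs_nonneg (lam / 2))
  have h2 := mul_le_mul_of_nonneg_left ht (abs_nonneg del)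
  have h3 : 0 ≤ s * (|del| * (C * 2)) * ‖x‖ := by positivity
  linarith

lemma integrable_exp_neg_mul_sum_sq {ι : Type*} [Fintype ι] {k : ℝ} (hk : 0 < k) :
    Integrable (fun x : ι → ℝ => Real.exp (-k * ∑ p, x p ^ 2)) := by
  have := Integrable.fintype_prod (ι := ι) (f := fun _ (t : ℝ) => Real.exp (-k * t ^ 2))
    (μ := fun _ => volume) fun _ => integrable_exp_neg_mul_sq hk
  have e : (fun x : ι → ℝ => Real.exp (-k * ∑ p, x p ^ 2)) =
      fun x => ∏ p, Real.exp (-k * x p ^ 2) := by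
    ext x
    rw [Finset.mul_sum, Real.exp_sum]
  rw [e]
  exact this

lemma one_add_mul_exp_le {k : ℝ} (hk : 0 < k) (r : ℝ) :
    (1 + r) * Real.exp (-(2 * k) * r ^ 2) ≤ (1 + 1 / (4 * k)) * Real.exp (-k * r ^ 2) := by
  have h1 : 1 + r ≤ (1 + 1 / (4 * k)) * Real.exp (k * r ^ 2) := by
    have h2 := Real.add_one_le_exp (k * r ^ 2)
    have h3 : r ≤ k * r ^ 2 + 1 / (4 * k) := by
      have : k * r ^ 2 + 1 / (4 * k) - r = k * (r - 1 / (2 * k)) ^ 2 := by field_simp; ring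
      nlinarith [mul_nonneg hk.le (sq_nonneg (r - 1 / (2 * k)))]
    have h4 : 0 ≤ 1 / (4 * k) * (k * r ^ 2) := by positivity
    have h5 := mul_le_mul_of_nonneg_left h2 (show 0 ≤ 1 + 1 / (4 * k) by positivity)
    nlinarith
  calc _ ≤ (1 + 1 / (4 * k)) * Real.exp (k * r ^ 2) * Real.exp (-(2 * k) * r ^ 2) := by gcongr
    _ = _ := by rw [mul_assoc, ← Real.exp_add]; ring_nf

lemma exists_logDens_le (hA : (Aᵀ * A).PosDef) (hlam : 0 < lam) (hdel : 0 ≤ del) :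
    ∃ k C : ℝ, 0 < k ∧ ∀ x, logDens n A y lam del ε x ≤ C - k * ‖x‖ ^ 2 := by
  have hker : LinearMap.ker A.mulVecLin = ⊥ := by
    rw [LinearMap.ker_eq_bot']
    intro x hx
    by_contra h0
    have := hA.dotProduct_mulVec_pos h0
    rw [← mulVec_mulVec, show A.mulVec x = 0 from hx, mulVec_zero, dotProduct_zero] at this
    exact lt_irrefl _ this
  obtain ⟨K, hK0, hK⟩ := A.mulVecLin.exists_antilipschitzWith hker
  have hb : ∀ x, ‖x‖ ≤ K * ‖A.mulVec x‖ := fun x => by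
    simpa using hK.le_mul_dist x 0
  have hK0' : (0 : ℝ) < K := hK0
  refine ⟨lam / (4 * K ^ 2), lam / 2 * ‖y‖ ^ 2, by positivity, fun x => ?_⟩
  have h1 : ‖y - A.mulVec x‖ ^ 2 ≤ ∑ β, (y β - A.mulVec x β) ^ 2 := by
    have hs : 0 ≤ ∑ β, (y β - A.mulVec x β) ^ 2 := Finset.sum_nonneg fun _ _ => sq_nonneg _
    have := (pi_norm_le_iff_of_nonneg (x := y - A.mulVec x) (Real.sqrt_nonneg _)).2 fun β =>
      Real.abs_le_sqrt (Finset.single_le_sum (f := fun β => (y β - A.mulVec x β) ^ 2)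
        (fun _ _ => sq_nonneg _) (Finset.mem_univ β))
    exact (pow_le_pow_left₀ (norm_nonneg _) this 2).trans (Real.sq_sqrt hs).le
  have h2 : ‖A.mulVec x‖ ≤ ‖y - A.mulVec x‖ + ‖y‖ := by
    rw [← norm_neg (y - A.mulVec x), neg_sub]
    exact norm_le_norm_sub_add _ _
  have h3 : ‖A.mulVec x‖ ^ 2 ≤ 2 * ‖y - A.mulVec x‖ ^ 2 + 2 * ‖y‖ ^ 2 := by
    nlinarith [norm_nonneg (A.mulVec x), sq_nonneg (‖y - A.mulVec x‖ - ‖y‖)]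
  have h4 : ‖x‖ ^ 2 / K ^ 2 ≤ ‖A.mulVec x‖ ^ 2 := by
    rw [div_le_iff₀ (by positivity), ← mul_pow, mul_comm]
    exact pow_le_pow_left₀ (norm_nonneg _) (hb x) 2
  have h5 := mul_nonneg hdel (tv_nonneg n ε x)
  have h6 : lam / (4 * K ^ 2) * ‖x‖ ^ 2 = lam / 4 * (‖x‖ ^ 2 / K ^ 2) := by field_simp
  unfold logDens
  rw [h6]
  nlinarith

lemma integrable_one_add_norm_mul_exp_logDens (hA : (Aᵀ * A).PosDef) (hlam : 0 < lam)
    (hdel : 0 ≤ del) :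
    Integrable (fun x => (1 + ‖x‖) * Real.exp (logDens n A y lam del ε x)) := by
  obtain ⟨k, C, hk, hC⟩ := exists_logDens_le (ε := ε) y hA hlam hdel
  have hd : 0 < k / 2 / (Fintype.card (Pix n) + 1) := by positivity
  refine Integrable.mono' ((integrable_exp_neg_mul_sum_sq hd).const_mul
    (Real.exp C * (1 + 1 / (4 * (k / 2))))) ?_ (Filter.Eventually.of_forall fun x => ?_)
  · exact ((continuous_const.add continuous_norm).mul
      (Real.continuous_exp.comp (continuous_logDens y ε))).aestronglyMeasurable
  · rw [Real.norm_of_nonneg (by positivity)]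
    have hsum : ∑ p, x p ^ 2 ≤ (Fintype.card (Pix n) + 1) * ‖x‖ ^ 2 := by
      have : ∑ p, x p ^ 2 ≤ ∑ _p : Pix n, ‖x‖ ^ 2 := Finset.sum_le_sum fun p _ => by
        rw [← sq_abs]
        exact pow_le_pow_left₀ (abs_nonneg _) (norm_le_pi_norm x p) 2
      rw [Finset.sum_const, Finset.card_univ, nsmul_eq_mul] at this
      linarith [sq_nonneg ‖x‖]
    calc (1 + ‖x‖) * Real.exp (logDens n A y lam del ε x)
        ≤ (1 + ‖x‖) * Real.exp (C + -(2 * (k / 2)) * ‖x‖ ^ 2) := by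
          gcongr
          linarith [hC x]
      _ = Real.exp C * ((1 + ‖x‖) * Real.exp (-(2 * (k / 2)) * ‖x‖ ^ 2)) := by
          rw [Real.exp_add]; ring
      _ ≤ Real.exp C * ((1 + 1 / (4 * (k / 2))) * Real.exp (-(k / 2) * ‖x‖ ^ 2)) :=
          mul_le_mul_of_nonneg_left (one_add_mul_exp_le (half_pos hk) _) (Real.exp_pos _).le
      _ ≤ _ := by
          rw [← mul_assoc]
          refine mul_le_mul_of_nonneg_left (Real.exp_le_exp.2 ?_) (by positivity)
          rw [neg_mul, neg_mul, neg_le_neg_iff, div_mul_eq_mul_div, div_le_iff₀ (by positivity)]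
          nlinarith

lemma integrable_exp_logDens (hA : (Aᵀ * A).PosDef) (hlam : 0 < lam) (hdel : 0 ≤ del) :
    Integrable (fun x => Real.exp (logDens n A y lam del ε x)) := by
  refine (integrable_one_add_norm_mul_exp_logDens (ε := ε) y hA hlam hdel).mono'
    (Real.continuous_exp.comp (continuous_logDens y ε)).aestronglyMeasurable
    (Filter.Eventually.of_forall fun x => ?_)
  rw [Real.norm_of_nonneg (Real.exp_pos _).le]
  exact le_mul_of_one_le_left (Real.exp_pos _).le (by linarith [norm_nonneg x])

lemma post_eq_gibbs (n : ℕ) (A : Matrix (Pix n) (Pix n) ℝ) (y : Img n) (lam del ε : ℝ) :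
    post n A y lam del ε = gibbs (logDens n A y lam del ε)
      (volume.withDensity (fun x => ENNReal.ofReal (dens n A y lam del ε x)) Set.univ)⁻¹ := rfl

lemma mass_ne_zero :
    volume.withDensity (fun x => ENNReal.ofReal (dens n A y lam del ε x)) Set.univ ≠ 0 := by
  intro h
  have hac := withDensity_absolutelyContinuous' (μ := volume)
    (f := fun x => ENNReal.ofReal (Real.exp (logDens n A y lam del ε x)))
    (ENNReal.measurable_ofReal.comp
      (Real.measurable_exp.comp (continuous_logDens y ε).measurable)).aemeasurable
    (Filter.Eventually.of_forall fun x => (ENNReal.ofReal_pos.2 (Real.exp_pos _)).ne')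
  exact isOpen_univ.measure_ne_zero volume Set.univ_nonempty (hac h)

lemma mass_ne_top (hA : (Aᵀ * A).PosDef) (hlam : 0 < lam) (hdel : 0 ≤ del) :
    volume.withDensity (fun x => ENNReal.ofReal (dens n A y lam del ε x)) Set.univ ≠ ∞ := by
  rw [withDensity_apply _ MeasurableSet.univ, Measure.restrict_univ]
  exact (integrable_exp_logDens y hA hlam hdel).lintegral_lt_top.ne

lemma isProbabilityMeasure_post (hA : (Aᵀ * A).PosDef) (hlam : 0 < lam) (hdel : 0 ≤ del) :
    IsProbabilityMeasure (post n A y lam del ε) :=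
  ⟨by rw [post, Measure.smul_apply, smul_eq_mul]
      exact ENNReal.inv_mul_cancel (mass_ne_zero y) (mass_ne_top y hA hlam hdel)⟩

lemma tameLogDensity_logDens (hA : (Aᵀ * A).PosDef) (hlam : 0 < lam) (hdel : 0 ≤ del)
    (hε : 0 ≤ ε) (ε' : ℝ) :
    TameLogDensity (logDens n A y lam del ε) (post n A y lam del ε') where
  continuous := continuous_logDens y ε
  ae_differentiableAt := ((withDensity_absolutelyContinuous _ _).smul_left _).ae_le
    (ae_differentiableAt_logDens y hε)
  growth := exists_growth_logDens y hε
  integrable_norm := by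
    refine Integrable.smul_measure ?_ (ENNReal.inv_ne_top.2 (mass_ne_zero y))
    have hmeas : Measurable fun x => ENNReal.ofReal (dens n A y lam del ε' x) :=
      ENNReal.measurable_ofReal.comp (Real.measurable_exp.comp (continuous_logDens y ε').measurable)
    rw [integrable_withDensity_iff hmeas (Filter.Eventually.of_forall fun _ => ENNReal.ofReal_lt_top)]
    refine (integrable_one_add_norm_mul_exp_logDens (ε := ε') y hA hlam hdel).mono'
      (continuous_norm.measurable.mul hmeas.ennreal_toReal).aestronglyMeasurable
      (Filter.Eventually.of_forall fun x => ?_)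
    have h0 : 0 ≤ dens n A y lam del ε' x := (Real.exp_pos _).le
    rw [ENNReal.toReal_ofReal h0, Real.norm_of_nonneg (mul_nonneg (norm_nonneg _) h0)]
    exact mul_le_mul_of_nonneg_right (by linarith) (Real.exp_pos _).le

end Tail

lemma log_dens (n : ℕ) (A : Matrix (Pix n) (Pix n) ℝ) (y : Img n) (lam del ε : ℝ) :
    (fun z => Real.log (dens n A y lam del ε z)) = logDens n A y lam del ε :=
  funext fun _ => Real.log_exp _

lemma W1_map_blkRestrict_le {n m : ℕ} (hm : m ∣ n) (i : Blk n m) {μ ν : Measure (Img n)}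
    {γ : Measure (Img n × Img n)} (hγ : IsCoupling γ μ ν) :
    W1 (μ.map (blkRestrict m hm i)) (ν.map (blkRestrict m hm i)) ≤
      ∫ z, blkNorm (blkOf m hm) i (z.1 - z.2) ∂γ := by
  have hR : Measurable (blkRestrict m hm i) := measurable_pi_lambda _ fun p => measurable_pi_apply _
  refine csInf_le ⟨0, ?_⟩ ⟨γ.map (Prod.map (blkRestrict m hm i) (blkRestrict m hm i)), ?_, ?_, ?_⟩
  · rintro _ ⟨γ', -, -, rfl⟩
    exact integral_nonneg fun z => Real.sqrt_nonneg _
  · rw [Measure.map_map measurable_fst (hR.prodMap hR), ← hγ.1, Measure.map_map hR measurable_fst]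
    rfl
  · rw [Measure.map_map measurable_snd (hR.prodMap hR), ← hγ.2, Measure.map_map hR measurable_snd]
    rfl
  · rw [integral_map (hR.prodMap hR).aemeasurable]
    · exact integral_congr_ae (Filter.Eventually.of_forall fun z => (l2_blkRestrict hm i _).symm)
    · unfold l2
      exact Measurable.aestronglyMeasurable (by fun_prop)

/-- Stein's-method bound, Eq. (A.1): under `c`-diagonal block dominance of
`AᵀA` and `λ/δ ≥ 64 m/(c √ε)`, the Wasserstein-1 distance between the block marginals of
`π` and `π_ε` is bounded by `2/(λ c)` times the maximal `L¹(π)` block-score difference. -/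
theorem stmt6 (n m : ℕ) (hm : m ∣ n) (hn0 : 0 < n) (hm0 : 0 < m)
    (A : Matrix (Pix n) (Pix n) ℝ) (y : Img n) (lam del c ε : ℝ)
    (hlam : 0 < lam) (hdel : 0 < del) (hc : 0 < c) (hε : 0 < ε)
    (hdom : DiagBlockDom m hm (Aᵀ * A) c)
    (hratio : 64 * m / (c * Real.sqrt ε) ≤ lam / del) :
    ∀ i : Blk n m,
      W1 (Measure.map (blkRestrict m hm i) (post n A y lam del 0))
         (Measure.map (blkRestrict m hm i) (post n A y lam del ε)) ≤
      2 / (lam * c) *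
        ⨆ j : Blk n m,
          ∫ x, l2 (fun p : BlkPix m hm j =>
              pgrad (fun z => Real.log (dens n A y lam del ε z)) x p.val -
              pgrad (fun z => Real.log (dens n A y lam del 0 z)) x p.val)
            ∂(post n A y lam del 0) := by
  intro i
  obtain ⟨hpd, M, -, hdiag, hoff, hrow⟩ := hdom
  have : Nonempty (Pix n) := ⟨(⟨0, hn0⟩, ⟨0, hn0⟩)⟩
  have hμ : IsProbabilityMeasure (post n A y lam del 0) :=
    isProbabilityMeasure_post y hpd hlam hdel.le
  have hν : IsProbabilityMeasure (post n A y lam del ε) :=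
    isProbabilityMeasure_post y hpd hlam hdel.le
  have hsε : 0 < √ε := Real.sqrt_pos.2 hε
  have hτ : 32 * (del / √ε) ≤ lam * c / 2 := by
    have hm1 : (1 : ℝ) ≤ m := by exact_mod_cast hm0
    rw [div_le_div_iff₀ (by positivity) hdel] at hratio
    rw [← mul_div_assoc, div_le_iff₀ hsε]
    nlinarith [mul_le_mul_of_nonneg_right hm1 hdel.le]
  simp only [log_dens]
  have hl2 : ∀ (j : Blk n m) x, l2 (fun p : BlkPix m hm j =>
      pgrad (logDens n A y lam del ε) x p.val - pgrad (logDens n A y lam del 0) x p.val) =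
      blkNorm (blkOf m hm) j
        (score (logDens n A y lam del 0) x - score (logDens n A y lam del ε) x) := fun j x => by
    rw [← l2_blkRestrict]
    unfold l2
    exact congrArg _ (Finset.sum_congr rfl fun p _ => sub_sq_comm _ _)
  simp only [hl2]
  set D := ⨆ j : Blk n m, ∫ x, blkNorm (blkOf m hm) j
    (score (logDens n A y lam del 0) x - score (logDens n A y lam del ε) x) ∂(post n A y lam del 0)
  refine le_of_forall_pos_le_add fun e he => ?_
  obtain ⟨γ, hγ, hle⟩ := exists_coupling_integral_blkNorm_le (D := D)
    (post_eq_gibbs n A y lam del 0) (post_eq_gibbs n A y lam del ε)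
    (tameLogDensity_logDens y hpd hlam hdel.le le_rfl 0)
    (tameLogDensity_logDens y hpd hlam hdel.le hε.le ε)
    (tameLogDensity_logDens y hpd hlam hdel.le hε.le 0).integrable_score
    (show 0 < lam * c / 2 by positivity)
    (interaction_nonneg hm hoff hlam.le (div_nonneg hdel.le hsε.le))
    (sum_interaction_add_le hlam.le hrow (div_nonneg hdel.le hsε.le) hτ)
    (blockDissipative_logDens hm hdiag hoff y hlam.le hdel.le hε)
    (le_ciSup (Set.finite_range _).bddAbove) he
  refine (W1_map_blkRestrict_le hm i hγ).trans ((hle i).trans (le_of_eq ?_))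
  rw [div_div_eq_mul_div, div_mul_eq_mul_div, mul_comm D 2]

end
end

section
/- The smoothed TV potential φ_ε is twice continuously differentiable, and for any two distinct neighboring blocks i ∼ j (horizontally or vertically adjacent in the block grid), the (i,j) sub-block H_{ij}(x) ∈ ℝ^{q×q} of the Hessian H(x) = ∇²φ_ε(x) satisfies the operator norm bound ‖H_{ij}(x)‖₂ ≤ 8·m·δ·ε^{−1/2} for all x ∈ ℝ^d. -/
open MeasureTheory Matrix
open scoped Kronecker ENNReal

noncomputable section

/-- The `(i,j)` block of the Hessian of `f` at `x` (matrix of second partials). -/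
def hessBlk {n : ℕ} (m : ℕ) (hm : m ∣ n) (i j : Blk n m) (f : Img n → ℝ) (x : Img n) :
    Matrix (BlkPix m hm i) (BlkPix m hm j) ℝ :=
  Matrix.of fun p q =>
    fderiv ℝ (fun z => fderiv ℝ f z (Pi.single q.val 1)) x (Pi.single p.val 1)

/-- Vertical adjacency of blocks (same block-column, block-rows at distance 1). -/
def vertAdj {n m : ℕ} (i j : Blk n m) : Prop :=
  i.1 = j.1 ∧ Nat.dist (i.2 : ℕ) (j.2 : ℕ) = 1

/-- Horizontal adjacency of blocks (same block-row, block-columns at distance 1). -/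
def horizAdj {n m : ℕ} (i j : Blk n m) : Prop :=
  i.2 = j.2 ∧ Nat.dist (i.1 : ℕ) (j.1 : ℕ) = 1

/-- Two blocks are neighbors if they are distinct and horizontally or vertically adjacent. -/
def nbr {n m : ℕ} (i j : Blk n m) : Prop := i ≠ j ∧ (vertAdj i j ∨ horizAdj i j)

/-- The one-dimensional forward difference has squared operator norm at most `4`. -/
lemma sum_sq_Dmat_mulVec_le (n : ℕ) (v : Fin n → ℝ) :
    ∑ i, ((Dmat n).mulVec v i) ^ 2 ≤ 4 * ∑ i, v i ^ 2 := by
  have key : ∀ i, (Dmat n).mulVec v i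
      = (if h : (i : ℕ) + 1 < n then v ⟨i + 1, h⟩ else 0) - v i := by
    intro i
    have hsplit : ∀ j, Dmat n i j * v j
        = (if (j : ℕ) = (i : ℕ) + 1 then v j else 0) - (if j = i then v j else 0) := by
      intro j
      by_cases hji : j = i
      · subst hji
        simp [Dmat]
      · simp [Dmat, hji]
    simp only [Matrix.mulVec, dotProduct, hsplit, Finset.sum_sub_distrib]
    congr 1
    · split_ifs with h
      · rw [Finset.sum_eq_single ⟨i + 1, h⟩]
        · simp
        · intro b _ hb
          rw [if_neg]
          intro hb'
          exact hb (Fin.ext hb')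
        · simp
      · refine Finset.sum_eq_zero fun j _ => if_neg ?_
        have := j.isLt
        omega
    · simp
  have hshift : ∑ i : Fin n, (if h : (i : ℕ) + 1 < n then v ⟨i + 1, h⟩ else 0) ^ 2
      ≤ ∑ i, v i ^ 2 := by
    cases n with
    | zero => simp
    | succ k =>
      rw [Fin.sum_univ_castSucc, Fin.sum_univ_succ (fun i => v i ^ 2)]
      have : ∀ i : Fin k, (⟨(i : ℕ) + 1, by omega⟩ : Fin (k + 1)) = i.succ := fun i => rfl
      simp [this, sq_nonneg]
  calc ∑ i, ((Dmat n).mulVec v i) ^ 2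
      ≤ ∑ i : Fin n, (2 * (if h : (i : ℕ) + 1 < n then v ⟨i + 1, h⟩ else 0) ^ 2 + 2 * v i ^ 2) := by
        refine Finset.sum_le_sum fun i _ => ?_
        rw [key]
        nlinarith [sq_nonneg ((if h : (i : ℕ) + 1 < n then v ⟨i + 1, h⟩ else 0) + v i)]
    _ ≤ 4 * ∑ i, v i ^ 2 := by
        rw [Finset.sum_add_distrib, ← Finset.mul_sum, ← Finset.mul_sum]
        linarith

lemma Dv_mulVec_s9 (n : ℕ) (u : Img n) (i j : Fin n) :
    (Dv n).mulVec u (i, j) = (Dmat n).mulVec (fun k => u (i, k)) j := by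
  simp [Dv, Matrix.mulVec, dotProduct, Fintype.sum_prod_type, Matrix.one_apply]

lemma Dh_mulVec_s9 (n : ℕ) (u : Img n) (i j : Fin n) :
    (Dh n).mulVec u (i, j) = (Dmat n).mulVec (fun k => u (k, j)) i := by
  simp [Dh, Matrix.mulVec, dotProduct, Fintype.sum_prod_type, Matrix.one_apply]

/-- The discrete image gradient has squared operator norm at most `8`. -/
lemma sum_sq_grad_le (n : ℕ) (u : Img n) :
    ∑ α, (((Dv n).mulVec u α) ^ 2 + ((Dh n).mulVec u α) ^ 2) ≤ 8 * ∑ α, u α ^ 2 := by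
  have hv : ∑ α, ((Dv n).mulVec u α) ^ 2 ≤ 4 * ∑ α, u α ^ 2 := by
    simp only [Fintype.sum_prod_type, Dv_mulVec_s9]
    rw [Finset.mul_sum]
    exact Finset.sum_le_sum fun i _ => sum_sq_Dmat_mulVec_le n fun k => u (i, k)
  have hh : ∑ α, ((Dh n).mulVec u α) ^ 2 ≤ 4 * ∑ α, u α ^ 2 := by
    simp only [Fintype.sum_prod_type_right, Dh_mulVec_s9]
    rw [Finset.mul_sum]
    exact Finset.sum_le_sum fun j _ => sum_sq_Dmat_mulVec_le n fun k => u (k, j)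
  rw [Finset.sum_add_distrib]
  linarith

/-- The Hessian of `(a, b) ↦ √(a² + b² + ε)` at `(a, b)`, as a bilinear form. -/
def smoothNormHess (ε a b a₁ b₁ a₂ b₂ : ℝ) : ℝ :=
  (a₁ * a₂ + b₁ * b₂) / √(a ^ 2 + b ^ 2 + ε)
    - (a * a₁ + b * b₁) * (a * a₂ + b * b₂) / √(a ^ 2 + b ^ 2 + ε) ^ 3

lemma smoothNormHess_le {ε : ℝ} (hε : 0 < ε) (a b a₁ b₁ a₂ b₂ : ℝ) :
    smoothNormHess ε a b a₁ b₁ a₂ b₂ ≤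
      √(a₁ ^ 2 + b₁ ^ 2) * √(a₂ ^ 2 + b₂ ^ 2) / √ε := by
  set s := √(a ^ 2 + b ^ 2 + ε) with hs
  have hpos : 0 < a ^ 2 + b ^ 2 + ε := by positivity
  have hs0 : 0 < s := Real.sqrt_pos.mpr hpos
  have hs2 : s ^ 2 = a ^ 2 + b ^ 2 + ε := Real.sq_sqrt hpos.le
  have hεs : √ε ≤ s := Real.sqrt_le_sqrt (by nlinarith [sq_nonneg a, sq_nonneg b])
  have hform : smoothNormHess ε a b a₁ b₁ a₂ b₂
      = (ε * (a₁ * a₂ + b₁ * b₂) + (b * a₁ - a * b₁) * (b * a₂ - a * b₂)) / s ^ 2 / s := by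
    rw [smoothNormHess, ← hs]
    field_simp
    rw [hs2]
    ring
  have hcs : ε * (a₁ * a₂ + b₁ * b₂) + (b * a₁ - a * b₁) * (b * a₂ - a * b₂)
      ≤ s ^ 2 * (√(a₁ ^ 2 + b₁ ^ 2) * √(a₂ ^ 2 + b₂ ^ 2)) := by
    have h1 : a₁ * a₂ + b₁ * b₂ ≤ √(a₁ ^ 2 + b₁ ^ 2) * √(a₂ ^ 2 + b₂ ^ 2) := by
      rw [← Real.sqrt_mul (by positivity)]
      apply Real.le_sqrt_of_sq_le
      nlinarith [sq_nonneg (a₁ * b₂ - b₁ * a₂)]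
    have h2 : (b * a₁ - a * b₁) * (b * a₂ - a * b₂)
        ≤ (a ^ 2 + b ^ 2) * (√(a₁ ^ 2 + b₁ ^ 2) * √(a₂ ^ 2 + b₂ ^ 2)) := by
      have hle : ∀ p q : ℝ, |b * p - a * q| ≤ √(a ^ 2 + b ^ 2) * √(p ^ 2 + q ^ 2) := by
        intro p q
        rw [← Real.sqrt_mul (by positivity)]
        apply Real.abs_le_sqrt
        nlinarith [sq_nonneg (a * p + b * q)]
      calc (b * a₁ - a * b₁) * (b * a₂ - a * b₂)
          ≤ |b * a₁ - a * b₁| * |b * a₂ - a * b₂| := by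
            rw [← abs_mul]
            exact le_abs_self _
        _ ≤ (√(a ^ 2 + b ^ 2) * √(a₁ ^ 2 + b₁ ^ 2))
              * (√(a ^ 2 + b ^ 2) * √(a₂ ^ 2 + b₂ ^ 2)) := by
            gcongr <;> exact hle _ _
        _ = √(a ^ 2 + b ^ 2) ^ 2 * (√(a₁ ^ 2 + b₁ ^ 2) * √(a₂ ^ 2 + b₂ ^ 2)) := by ring
        _ = _ := by rw [Real.sq_sqrt (by positivity)]
    rw [hs2]
    nlinarith [mul_le_mul_of_nonneg_left h1 hε.le]
  rw [hform]
  have hε0 : 0 < √ε := Real.sqrt_pos.mpr hε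
  calc _ ≤ √(a₁ ^ 2 + b₁ ^ 2) * √(a₂ ^ 2 + b₂ ^ 2) / s := by
        gcongr
        rw [div_le_iff₀ (by positivity)]
        linarith
    _ ≤ _ := by gcongr

/-- Matrix-vector multiplication followed by evaluation at a coordinate, as a continuous
linear functional. -/
def rowCLM {ι κ : Type*} [Fintype κ] (A : Matrix ι κ ℝ) (α : ι) : (κ → ℝ) →L[ℝ] ℝ :=
  LinearMap.toContinuousLinearMap (LinearMap.proj α ∘ₗ A.mulVecLin)

lemma rowCLM_apply {ι κ : Type*} [Fintype κ] (A : Matrix ι κ ℝ) (α : ι) (x : κ → ℝ) :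
    rowCLM A α x = A.mulVec x α := rfl

lemma tv_eq (n : ℕ) (ε : ℝ) (x : Img n) :
    tv n ε x = ∑ α, √(rowCLM (Dv n) α x ^ 2 + rowCLM (Dh n) α x ^ 2 + ε) := rfl

section SmoothNorm

variable {E : Type*} [NormedAddCommGroup E] [NormedSpace ℝ E]

lemma contDiff_smoothNorm {ε : ℝ} (hε : 0 < ε) (a b : E →L[ℝ] ℝ) :
    ContDiff ℝ 2 fun x => √(a x ^ 2 + b x ^ 2 + ε) := by
  refine ContDiff.sqrt (by fun_prop) fun x => ?_
  positivity

lemma hasFDerivAt_smoothNorm {ε : ℝ} (hε : 0 < ε) (a b : E →L[ℝ] ℝ) (x : E) :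
    HasFDerivAt (fun x => √(a x ^ 2 + b x ^ 2 + ε))
      ((√(a x ^ 2 + b x ^ 2 + ε))⁻¹ • (a x • a + b x • b)) x := by
  have hpos : a x ^ 2 + b x ^ 2 + ε ≠ 0 := by positivity
  have h := (((a.hasFDerivAt (x := x)).pow 2).add ((b.hasFDerivAt (x := x)).pow 2)).add_const ε
  refine (h.sqrt hpos).congr_fderiv ?_
  ext v
  simp
  field_simp

lemma hasFDerivAt_smoothNorm_fderiv {ε : ℝ} (hε : 0 < ε) (a b : E →L[ℝ] ℝ) (w x : E) :
    ∃ L : E →L[ℝ] ℝ,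
      HasFDerivAt (fun z => (√(a z ^ 2 + b z ^ 2 + ε))⁻¹ * (a z * a w + b z * b w)) L x ∧
      ∀ u, L u = smoothNormHess ε (a x) (b x) (a u) (b u) (a w) (b w) := by
  have hpos : 0 < √(a x ^ 2 + b x ^ 2 + ε) := by positivity
  have h1 := (hasDerivAt_inv hpos.ne').comp_hasFDerivAt x (hasFDerivAt_smoothNorm hε a b x)
  have h2 := ((a.hasFDerivAt (x := x)).mul_const (a w)).add
    ((b.hasFDerivAt (x := x)).mul_const (b w))
  refine ⟨_, h1.mul h2, fun u => ?_⟩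
  simp [smoothNormHess]
  field_simp
  ring

end SmoothNorm

lemma contDiff_tv (n : ℕ) (del : ℝ) {ε : ℝ} (hε : 0 < ε) :
    ContDiff ℝ 2 fun x : Img n => del * tv n ε x := by
  simp only [tv_eq]
  exact contDiff_const.mul (ContDiff.sum fun α _ => contDiff_smoothNorm hε _ _)

lemma fderiv_tv_apply (n : ℕ) (del : ℝ) {ε : ℝ} (hε : 0 < ε) (x w : Img n) :
    fderiv ℝ (fun z : Img n => del * tv n ε z) x w = del * ∑ α,
      (√(rowCLM (Dv n) α x ^ 2 + rowCLM (Dh n) α x ^ 2 + ε))⁻¹ *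
        (rowCLM (Dv n) α x * rowCLM (Dv n) α w + rowCLM (Dh n) α x * rowCLM (Dh n) α w) := by
  simp only [tv_eq]
  have h := (HasFDerivAt.fun_sum (u := Finset.univ) fun α _ =>
    hasFDerivAt_smoothNorm hε (rowCLM (Dv n) α) (rowCLM (Dh n) α) x).const_mul del
  rw [h.fderiv]
  simp [mul_add]

lemma fderiv_fderiv_tv_apply (n : ℕ) (del : ℝ) {ε : ℝ} (hε : 0 < ε) (x u w : Img n) :
    fderiv ℝ (fun z => fderiv ℝ (fun z : Img n => del * tv n ε z) z w) x u = del * ∑ α,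
      smoothNormHess ε ((Dv n).mulVec x α) ((Dh n).mulVec x α) ((Dv n).mulVec u α)
        ((Dh n).mulVec u α) ((Dv n).mulVec w α) ((Dh n).mulVec w α) := by
  simp only [fderiv_tv_apply n del hε]
  choose L hL hLu using fun α =>
    hasFDerivAt_smoothNorm_fderiv hε (rowCLM (Dv n) α) (rowCLM (Dh n) α) w x
  rw [((HasFDerivAt.fun_sum (u := Finset.univ) fun α _ => hL α).const_mul del).fderiv]
  simp [hLu, rowCLM_apply]

/-- The second derivative of the smoothed TV potential is bounded by `8 δ / √ε`. -/
lemma fderiv_fderiv_tv_le (n : ℕ) {del ε : ℝ} (hdel : 0 < del) (hε : 0 < ε) (x u w : Img n) :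
    fderiv ℝ (fun z => fderiv ℝ (fun z : Img n => del * tv n ε z) z w) x u ≤
      8 * del / √ε * (√(∑ α, u α ^ 2) * √(∑ α, w α ^ 2)) := by
  rw [fderiv_fderiv_tv_apply n del hε]
  have hgrad : ∀ v : Img n, √(∑ α, (((Dv n).mulVec v α) ^ 2 + ((Dh n).mulVec v α) ^ 2))
      ≤ √8 * √(∑ α, v α ^ 2) := by
    intro v
    rw [← Real.sqrt_mul (by norm_num)]
    exact Real.sqrt_le_sqrt (sum_sq_grad_le n v)
  have h8 : √8 * √8 = (8 : ℝ) := Real.mul_self_sqrt (by norm_num)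
  calc _ ≤ del * ∑ α, √(((Dv n).mulVec u α) ^ 2 + ((Dh n).mulVec u α) ^ 2) *
          √(((Dv n).mulVec w α) ^ 2 + ((Dh n).mulVec w α) ^ 2) / √ε := by
        gcongr
        exact smoothNormHess_le hε _ _ _ _ _ _
    _ = del / √ε * ∑ α, √(((Dv n).mulVec u α) ^ 2 + ((Dh n).mulVec u α) ^ 2) *
          √(((Dv n).mulVec w α) ^ 2 + ((Dh n).mulVec w α) ^ 2) := by
        rw [← Finset.sum_div]
        ring
    _ ≤ del / √ε * (√(∑ α, (((Dv n).mulVec u α) ^ 2 + ((Dh n).mulVec u α) ^ 2)) *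
          √(∑ α, (((Dv n).mulVec w α) ^ 2 + ((Dh n).mulVec w α) ^ 2))) := by
        gcongr
        exact Real.sum_sqrt_mul_sqrt_le _ (fun α => by positivity) (fun α => by positivity)
    _ ≤ del / √ε * ((√8 * √(∑ α, u α ^ 2)) * (√8 * √(∑ α, w α ^ 2))) := by
        gcongr
        · exact hgrad u
        · exact hgrad w
    _ = del / √ε * (√8 * √8) * (√(∑ α, u α ^ 2) * √(∑ α, w α ^ 2)) := by ring
    _ = _ := by
        rw [h8]
        ring

lemma opNorm_le_of_bilin_le {ι κ : Type*} [Fintype ι] [Fintype κ] [DecidableEq ι] [DecidableEq κ]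
    (A : Matrix ι κ ℝ) {C : ℝ} (hC : 0 ≤ C)
    (h : ∀ (u : ι → ℝ) (w : κ → ℝ),
      u ⬝ᵥ A.mulVec w ≤ C * (√(∑ p, u p ^ 2) * √(∑ q, w q ^ 2))) :
    opNorm A ≤ C := by
  refine ContinuousLinearMap.opNorm_le_bound _ hC fun w => ?_
  have hw := h (A.mulVec w) w
  have hdot : A.mulVec w ⬝ᵥ A.mulVec w = ∑ p, A.mulVec w p ^ 2 := by
    simp [dotProduct, sq]
  have hn : ‖LinearMap.toContinuousLinearMap (Matrix.toEuclideanLin A) w‖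
      = √(∑ p, A.mulVec w p ^ 2) := by
    simp [EuclideanSpace.norm_eq, Matrix.toLpLin_apply]
  have hnw : ‖w‖ = √(∑ q, w q ^ 2) := by simp [EuclideanSpace.norm_eq]
  rw [hn, hnw]
  set t := √(∑ p, A.mulVec w p ^ 2) with ht
  have ht2 : t * t = ∑ p, A.mulVec w p ^ 2 := Real.mul_self_sqrt (by positivity)
  rw [hdot, ← ht2] at hw
  rcases (Real.sqrt_nonneg _ : 0 ≤ t).eq_or_lt with h0 | hpos
  · exact h0.symm.trans_le (by positivity)
  · refine le_of_mul_le_mul_left ?_ hpos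
    linarith

/-- Extension by zero of a vector indexed by the pixels of a block. -/
def blkExtend {n : ℕ} (m : ℕ) (hm : m ∣ n) (i : Blk n m) (u : BlkPix m hm i → ℝ) : Img n :=
  ∑ p, u p • Pi.single p.val 1

lemma blkExtend_apply {n : ℕ} (m : ℕ) (hm : m ∣ n) (i : Blk n m) (u : BlkPix m hm i → ℝ)
    (α : Pix n) : blkExtend m hm i u α = if h : blkOf m hm α = i then u ⟨α, h⟩ else 0 := by
  simp only [blkExtend, Finset.sum_apply, Pi.smul_apply, Pi.single_apply, smul_eq_mul,
    mul_ite, mul_one, mul_zero]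
  split_ifs with h
  · rw [Finset.sum_eq_single ⟨α, h⟩]
    · simp
    · intro b _ hb
      rw [if_neg]
      intro hb'
      exact hb (Subtype.ext hb'.symm)
    · simp
  · refine Finset.sum_eq_zero fun p _ => if_neg ?_
    rintro rfl
    exact h p.2

lemma sum_sq_blkExtend {n : ℕ} (m : ℕ) (hm : m ∣ n) (i : Blk n m) (u : BlkPix m hm i → ℝ) :
    ∑ α, blkExtend m hm i u α ^ 2 = ∑ p, u p ^ 2 := by
  rw [← Fintype.sum_subtype_add_sum_subtype (fun α => blkOf m hm α = i)]
  have h1 : ∀ p : BlkPix m hm i, blkExtend m hm i u p = u p := fun p => by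
    rw [blkExtend_apply, dif_pos p.2]
  have h2 : ∀ p : {α // ¬ blkOf m hm α = i}, blkExtend m hm i u p = 0 := fun p => by
    rw [blkExtend_apply, dif_neg p.2]
  simp [h1, h2]

lemma dotProduct_hessBlk_mulVec {n : ℕ} (m : ℕ) (hm : m ∣ n) (i j : Blk n m) {f : Img n → ℝ}
    (hf : ContDiff ℝ 2 f) (x : Img n) (u : BlkPix m hm i → ℝ) (w : BlkPix m hm j → ℝ) :
    u ⬝ᵥ (hessBlk m hm i j f x).mulVec w =
      fderiv ℝ (fun z => fderiv ℝ f z (blkExtend m hm j w)) x (blkExtend m hm i u) := by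
  have hd : DifferentiableAt ℝ (fderiv ℝ f) x :=
    (hf.fderiv_right (m := 1) (by norm_num)).differentiable (by norm_num) x
  have hbil : ∀ a b : Img n, fderiv ℝ (fun z => fderiv ℝ f z b) x a
      = fderiv ℝ (fderiv ℝ f) x a b := by
    intro a b
    rw [fderiv_clm_apply hd (differentiableAt_const b)]
    simp
  simp only [hessBlk, dotProduct, Matrix.mulVec, Matrix.of_apply, hbil]
  simp only [blkExtend, map_sum, map_smul, _root_.sum_apply, _root_.smul_apply, smul_eq_mul,
    Finset.mul_sum]
  rw [Finset.sum_comm]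
  refine Finset.sum_congr rfl fun q _ => ?_
  rw [← Finset.mul_sum, Finset.mul_sum]
  exact Finset.sum_congr rfl fun p _ => by ring

/-- Eq. (A.4): the smoothed TV potential `φ_ε = δ · tv_ε` is `C²`, and for
distinct neighboring blocks `i ∼ j` its Hessian block satisfies
`‖H_{ij}(x)‖₂ ≤ 8 m δ ε^{-1/2}` for all `x`. -/
theorem stmt9 (n m : ℕ) (hm : m ∣ n) (hm0 : 0 < m) (del ε : ℝ) (hdel : 0 < del) (hε : 0 < ε) :
    ContDiff ℝ 2 (fun x : Img n => del * tv n ε x) ∧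
    ∀ i j : Blk n m, nbr i j → ∀ x : Img n,
      opNorm (hessBlk m hm i j (fun z => del * tv n ε z) x) ≤
        8 * m * del / Real.sqrt ε := by
  have hC2 := contDiff_tv n del hε
  refine ⟨hC2, fun i j _ x => opNorm_le_of_bilin_le _ (by positivity) fun u w => ?_⟩
  rw [dotProduct_hessBlk_mulVec m hm i j hC2]
  refine (fderiv_fderiv_tv_le n hdel hε x _ _).trans ?_
  rw [sum_sq_blkExtend, sum_sq_blkExtend]
  have h1 : (1 : ℝ) ≤ m := by exact_mod_cast hm0
  gcongr
  linarith

end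
end
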